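/- arXiv:1908.08611 — 3 statements merged into one kernel-verified Lean document; each statement's English description precedes it below -/
import Mathlib

section
/- Fix an integer k ≥ 1. Then, as m → ∞: (i) (m/k!)·H_k(m) − ∑_{j=0}^{k−1} ( A_j/(k−1−j)! )·(log m)^{k−1−j} tends to 0, and (ii) (m/k!)·Z_k(m) − ∑_{j=0}^{k−1} ( B_j/(k−1−j)! )·(log m)^{k−1−j} tends to 0. Equivalently, H_k(m) = (k!/m)·( ∑_{j=0}^{k−1} A_j (log m)^{k−1−j}/(k−1−j)! + o(1) ) and Z_k(m) = (k!/m)·( ∑_{j=0}^{k−1} B_j (log m)^{k−1−j}/(k−1−j)! + o(1) ). -/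
open Filter

/-- The Riemann zeta value `ζ(s) = ∑_{n ≥ 1} n^{−s}` for a natural exponent `s`. -/
noncomputable def zetaSum (s : ℕ) : ℝ := ∑' n : ℕ, 1 / ((n : ℝ) + 1) ^ s

/-- The multiple harmonic sum `H_k(m) = ∑_{j₁+⋯+j_k=m} 1/(j₁⋯j_k)`, where the sum ranges
over ordered `k`-tuples of positive integers with sum `m`. -/
noncomputable def Hsum (k m : ℕ) : ℝ :=
  ∑ j ∈ (Fintype.piFinset fun _ : Fin k => Finset.Icc 1 m).filter
      (fun j => ∑ i, j i = m),
    ∏ i, (1 : ℝ) / (j i : ℝ)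

/-- The multiple harmonic zeta sum `Z_k(m) = ∑_{j₁+⋯+j_k=m} ζ(2j₁)⋯ζ(2j_k)/(j₁⋯j_k)`. -/
noncomputable def Zsum (k m : ℕ) : ℝ :=
  ∑ j ∈ (Fintype.piFinset fun _ : Fin k => Finset.Icc 1 m).filter
      (fun j => ∑ i, j i = m),
    ∏ i, zetaSum (2 * j i) / (j i : ℝ)

/-- `c_j = (1/j!)·∫_0^∞ e^{−u}(log u)^j du`, the `j`-th Taylor coefficient of the Gamma
function at `1`. -/
noncomputable def cGamma (j : ℕ) : ℝ :=
  (1 / (Nat.factorial j : ℝ)) * ∫ u in Set.Ioi (0 : ℝ), Real.exp (-u) * (Real.log u) ^ j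

/-- Moments of the Gamma distribution against powers of the logarithm. -/
noncomputable def momInt (m j : ℕ) : ℝ :=
  ∫ u in Set.Ioi (0 : ℝ), Real.exp (-u) * u ^ m * (Real.log u) ^ j

lemma abs_log_pow_le (j : ℕ) {u : ℝ} (hu : 0 < u) :
    |Real.log u| ^ j ≤ (j.factorial * 2 ^ j : ℝ) * (u ^ (1 / 2 : ℝ) + u ^ (-(1 / 2) : ℝ)) := by
  have h1 : (|Real.log u| / 2) ^ j / (j.factorial : ℝ) ≤ Real.exp (|Real.log u| / 2) :=
    Real.pow_div_factorial_le_exp _ (by positivity) j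
  have h2 : Real.exp (|Real.log u| / 2) ≤ u ^ (1 / 2 : ℝ) + u ^ (-(1 / 2) : ℝ) := by
    rw [Real.rpow_def_of_pos hu, Real.rpow_def_of_pos hu]
    rcases abs_cases (Real.log u) with ⟨h, _⟩ | ⟨h, _⟩
    · rw [h]
      have : Real.log u / 2 = Real.log u * (1 / 2) := by ring
      rw [this]
      linarith [Real.exp_pos (Real.log u * (-(1 / 2)))]
    · rw [h]
      have : -Real.log u / 2 = Real.log u * (-(1 / 2)) := by ring
      rw [this]
      linarith [Real.exp_pos (Real.log u * (1 / 2))]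
  have h3 := h1.trans h2
  rw [div_pow, div_div, div_le_iff₀ (by positivity)] at h3
  linarith

lemma gamma_bound_pow (m j : ℕ) {u : ℝ} (hu : 0 < u) :
    |Real.exp (-u) * u ^ m * (Real.log u) ^ j| ≤
      (j.factorial * 2 ^ j : ℝ) * (Real.exp (-u) * u ^ ((m + 3 / 2 : ℝ) - 1)
        + Real.exp (-u) * u ^ ((m + 1 / 2 : ℝ) - 1)) := by
  rw [abs_mul, abs_of_pos (by positivity : 0 < Real.exp (-u) * u ^ m), abs_pow]
  have e1 : u ^ ((m + 3 / 2 : ℝ) - 1) = u ^ m * u ^ (1 / 2 : ℝ) := by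
    rw [← Real.rpow_natCast, ← Real.rpow_add hu]; ring_nf
  have e2 : u ^ ((m + 1 / 2 : ℝ) - 1) = u ^ m * u ^ (-(1 / 2) : ℝ) := by
    rw [← Real.rpow_natCast, ← Real.rpow_add hu]; ring_nf
  rw [e1, e2]
  have := mul_le_mul_of_nonneg_left (abs_log_pow_le j hu)
    (by positivity : 0 ≤ Real.exp (-u) * u ^ m)
  refine this.trans (le_of_eq ?_)
  ring

lemma momInt_integrable (m j : ℕ) :
    MeasureTheory.IntegrableOn (fun u : ℝ => Real.exp (-u) * u ^ m * (Real.log u) ^ j)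
      (Set.Ioi 0) := by
  have i1 := Real.GammaIntegral_convergent (s := (m + 3 / 2 : ℝ)) (by positivity)
  have i2 := Real.GammaIntegral_convergent (s := (m + 1 / 2 : ℝ)) (by positivity)
  refine MeasureTheory.Integrable.mono' ((i1.add i2).const_mul (j.factorial * 2 ^ j : ℝ)) ?_ ?_
  · exact (by fun_prop : Measurable
      (fun u : ℝ => Real.exp (-u) * u ^ m * (Real.log u) ^ j)).aestronglyMeasurable
  · filter_upwards [MeasureTheory.ae_restrict_mem measurableSet_Ioi] with u hu
    exact gamma_bound_pow m j hu

lemma momInt_rec (m j : ℕ) :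
    momInt (m + 1) j = (m + 1) * momInt m j + j * momInt m (j - 1) := by
  have hd : ∀ u ∈ Set.Ioi (0 : ℝ), HasDerivAt
      (fun u : ℝ => Real.exp (-u) * u ^ (m + 1) * (Real.log u) ^ j)
      (((m + 1 : ℝ) * (Real.exp (-u) * u ^ m * (Real.log u) ^ j)
        + j * (Real.exp (-u) * u ^ m * (Real.log u) ^ (j - 1)))
        - Real.exp (-u) * u ^ (m + 1) * (Real.log u) ^ j) u := by
    intro u hu
    have hu' : u ≠ 0 := ne_of_gt hu
    have h1 : HasDerivAt (fun u : ℝ => Real.exp (-u)) (Real.exp (-u) * (-1)) u :=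
      (hasDerivAt_neg u).exp
    have h2 : HasDerivAt (fun u : ℝ => u ^ (m + 1)) (((m + 1 : ℕ) : ℝ) * u ^ m) u := by
      simpa using hasDerivAt_pow (m + 1) u
    have h3 : HasDerivAt (fun u : ℝ => (Real.log u) ^ j)
        (j * (Real.log u) ^ (j - 1) * u⁻¹) u := (Real.hasDerivAt_log hu').pow j
    refine ((h1.mul h2).mul h3).congr_deriv ?_
    simp only [Pi.mul_apply]
    push_cast
    have e : u ^ (m + 1) * u⁻¹ = u ^ m := by rw [pow_succ]; field_simp
    linear_combination (Real.exp (-u) * j * (Real.log u) ^ (j - 1)) * e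
  have ii := ((momInt_integrable m j).const_mul (m + 1 : ℝ)).add
    ((momInt_integrable m (j - 1)).const_mul (j : ℝ))
  have iii := ii.sub (momInt_integrable (m + 1) j)
  have key := MeasureTheory.integral_Ioi_of_hasDerivAt_of_tendsto (m := (0 : ℝ)) (a := (0 : ℝ))
    (f := (fun u : ℝ => Real.exp (-u) * u ^ (m + 1) * (Real.log u) ^ j)) ?_ hd iii ?_
  · have e := MeasureTheory.integral_sub ii (momInt_integrable (m + 1) j)
    have e2 := MeasureTheory.integral_add ((momInt_integrable m j).const_mul (m + 1 : ℝ))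
      ((momInt_integrable m (j - 1)).const_mul (j : ℝ))
    simp only [Pi.add_apply] at e e2
    rw [e, e2, MeasureTheory.integral_const_mul, MeasureTheory.integral_const_mul] at key
    simp only [zero_pow (Nat.succ_ne_zero m), mul_zero, zero_mul, sub_zero] at key
    simp only [momInt]
    linarith
  · rw [← continuousWithinAt_Ioi_iff_Ici]
    unfold ContinuousWithinAt
    simp only [zero_pow (Nat.succ_ne_zero m), mul_zero, zero_mul]
    refine squeeze_zero_norm' (a := fun u : ℝ => (j.factorial * 2 ^ j : ℝ) *
      (Real.exp (-u) * u ^ (((m + 1 : ℕ) + 3 / 2 : ℝ) - 1)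
        + Real.exp (-u) * u ^ (((m + 1 : ℕ) + 1 / 2 : ℝ) - 1))) ?_ ?_
    · filter_upwards [self_mem_nhdsWithin] with u hu
      exact gamma_bound_pow (m + 1) j hu
    · have : Continuous (fun u : ℝ => (j.factorial * 2 ^ j : ℝ) *
        (Real.exp (-u) * u ^ (((m + 1 : ℕ) + 3 / 2 : ℝ) - 1)
        + Real.exp (-u) * u ^ (((m + 1 : ℕ) + 1 / 2 : ℝ) - 1))) := by
        have c1 : Continuous (fun u : ℝ => u ^ (((m + 1 : ℕ) + 3 / 2 : ℝ) - 1)) :=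
          Real.continuous_rpow_const (by push_cast; linarith [(Nat.cast_nonneg m : (0 : ℝ) ≤ m)])
        have c2 : Continuous (fun u : ℝ => u ^ (((m + 1 : ℕ) + 1 / 2 : ℝ) - 1)) :=
          Real.continuous_rpow_const (by push_cast; linarith [(Nat.cast_nonneg m : (0 : ℝ) ≤ m)])
        fun_prop
      have h := (this.tendsto 0).mono_left (nhdsWithin_le_nhds (s := Set.Ioi 0))
      convert h using 2
      rw [Real.zero_rpow, Real.zero_rpow]
      · simp
      · push_cast; intro h; linarith [(Nat.cast_nonneg m : (0 : ℝ) ≤ m)]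
      · push_cast; intro h; linarith [(Nat.cast_nonneg m : (0 : ℝ) ≤ m)]
  · refine squeeze_zero_norm' (a := fun u : ℝ => (j.factorial * 2 ^ j : ℝ) *
      (Real.exp (-u) * u ^ (((m + 1 : ℕ) + 3 / 2 : ℝ) - 1)
        + Real.exp (-u) * u ^ (((m + 1 : ℕ) + 1 / 2 : ℝ) - 1))) ?_ ?_
    · filter_upwards [eventually_gt_atTop 0] with u hu
      exact gamma_bound_pow (m + 1) j hu
    · have t1 := tendsto_rpow_mul_exp_neg_mul_atTop_nhds_zero
        (((m + 1 : ℕ) + 3 / 2 : ℝ) - 1) 1 one_pos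
      have t2 := tendsto_rpow_mul_exp_neg_mul_atTop_nhds_zero
        (((m + 1 : ℕ) + 1 / 2 : ℝ) - 1) 1 one_pos
      have := (t1.add t2).const_mul (j.factorial * 2 ^ j : ℝ)
      simp only [add_zero, mul_zero] at this
      refine this.congr fun u => ?_
      rw [neg_one_mul]
      ring

lemma momInt_zero_right (m : ℕ) : momInt m 0 = m.factorial := by
  induction m with
  | zero => simp [momInt, integral_exp_Iic]
  | succ m ih => rw [momInt_rec, ih]; push_cast [Nat.factorial_succ]; simp

/-- Normalised moments. -/
noncomputable def gMom (m j : ℕ) : ℝ := momInt m j / (m.factorial * j.factorial)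

lemma gMom_succ (m j : ℕ) : gMom (m + 1) (j + 1) = gMom m (j + 1) + gMom m j / (m + 1) := by
  unfold gMom
  rw [momInt_rec]
  push_cast [Nat.factorial_succ]
  have : (m.factorial : ℝ) ≠ 0 := by positivity
  have : (j.factorial : ℝ) ≠ 0 := by positivity
  have : (m + 1 : ℝ) ≠ 0 := by positivity
  have : (j + 1 : ℝ) ≠ 0 := by positivity
  field_simp

lemma gMom_zero_right (m : ℕ) : gMom m 0 = 1 := by
  unfold gMom
  rw [momInt_zero_right]
  have : (m.factorial : ℝ) ≠ 0 := by positivity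
  simp [this]

lemma cGamma_eq (j : ℕ) : cGamma j = gMom 0 j := by
  unfold cGamma gMom momInt
  simp
  ring
/-- Centered logarithmic moments. -/
noncomputable def cenInt (m i : ℕ) : ℝ :=
  ∫ u in Set.Ioi (0 : ℝ), Real.exp (-u) * u ^ m * (Real.log u - Real.log (m + 1)) ^ i

lemma cenInt_integrable (m i : ℕ) :
    MeasureTheory.IntegrableOn
      (fun u : ℝ => Real.exp (-u) * u ^ m * (Real.log u - Real.log (m + 1)) ^ i)
      (Set.Ioi 0) := by
  have h : (fun u : ℝ => Real.exp (-u) * u ^ m * (Real.log u - Real.log (m + 1)) ^ i)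
      = fun u : ℝ => ∑ l ∈ Finset.range (i + 1),
        ((-Real.log (m + 1)) ^ (i - l) * (i.choose l : ℝ)) *
          (Real.exp (-u) * u ^ m * (Real.log u) ^ l) := by
    funext u
    rw [sub_eq_add_neg, add_pow, Finset.mul_sum]
    refine Finset.sum_congr rfl fun l _ => ?_
    ring
  rw [h]
  exact MeasureTheory.integrable_finsetSum _ fun l _ => (momInt_integrable m l).const_mul _

lemma momInt_eq_sum (m j : ℕ) :
    momInt m j = ∑ i ∈ Finset.range (j + 1),
      (Real.log (m + 1) ^ (j - i) * (j.choose i : ℝ)) * cenInt m i := by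
  unfold momInt cenInt
  simp_rw [← MeasureTheory.integral_const_mul]
  rw [← MeasureTheory.integral_finsetSum _ fun l _ => (cenInt_integrable m l).const_mul _]
  congr 1
  funext u
  have : Real.log u = (Real.log u - Real.log (m + 1)) + Real.log (m + 1) := by ring
  conv_lhs => rw [this, add_pow, Finset.mul_sum]
  refine Finset.sum_congr rfl fun l _ => ?_
  ring

lemma cenInt_zero (m : ℕ) : cenInt m 0 = m.factorial := by
  rw [← momInt_zero_right]; simp [cenInt, momInt]

lemma abs_pow_le_cosh (i : ℕ) (hi : 2 ≤ i) (t : ℝ) :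
    |t| ^ i ≤ i.factorial * (Real.exp t + Real.exp (-t) - 2) := by
  have h1 : 1 + |t| + |t| ^ i / i.factorial ≤ Real.exp |t| := by
    have h := Real.sum_le_exp_of_nonneg (abs_nonneg t) (i + 1)
    rw [Finset.sum_range_succ] at h
    have h2 : ∑ l ∈ Finset.range 2, |t| ^ l / (l.factorial : ℝ)
        ≤ ∑ l ∈ Finset.range i, |t| ^ l / (l.factorial : ℝ) :=
      Finset.sum_le_sum_of_subset_of_nonneg (Finset.range_mono hi)
        (fun _ _ _ => by positivity)
    simp [Finset.sum_range_succ] at h2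
    linarith
  have h2 : Real.exp |t| + Real.exp (-|t|) = Real.exp t + Real.exp (-t) := by
    rcases abs_cases t with ⟨h, _⟩ | ⟨h, _⟩ <;> rw [h]
    rw [neg_neg, add_comm]
  have h3 := Real.add_one_le_exp (-|t|)
  have h4 : |t| ^ i / i.factorial ≤ Real.exp t + Real.exp (-t) - 2 := by linarith
  rw [div_le_iff₀ (by positivity)] at h4
  linarith

lemma cenInt_bound (n i : ℕ) (hi : 1 ≤ i) :
    |cenInt (n + 1) i| ≤ i.factorial * n.factorial := by
  set N : ℝ := ((n + 1 : ℕ) : ℝ) + 1 with hN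
  have hNpos : 0 < N := by positivity
  have w1 : ∀ u ∈ Set.Ioi (0 : ℝ), Real.exp (-u) * u ^ (n + 1) * (u / N) =
      N⁻¹ * (Real.exp (-u) * u ^ (n + 2) * (Real.log u) ^ 0) := by
    intro u _
    simp; ring
  have w2 : ∀ u ∈ Set.Ioi (0 : ℝ), Real.exp (-u) * u ^ (n + 1) * (N / u) =
      N * (Real.exp (-u) * u ^ n * (Real.log u) ^ 0) := by
    intro u hu
    have hu' : u ≠ 0 := ne_of_gt hu
    rw [pow_succ]; field_simp
  have w0 : ∀ u ∈ Set.Ioi (0 : ℝ), Real.exp (-u) * u ^ (n + 1) * 1 =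
      (Real.exp (-u) * u ^ (n + 1) * (Real.log u) ^ 0) := by
    intro u hu
    simp
  have i1 : MeasureTheory.IntegrableOn (fun u : ℝ => Real.exp (-u) * u ^ (n + 1) * (u / N))
      (Set.Ioi 0) := by
    rw [MeasureTheory.integrableOn_congr_fun w1 measurableSet_Ioi]
    exact (momInt_integrable _ _).const_mul _
  have i2 : MeasureTheory.IntegrableOn (fun u : ℝ => Real.exp (-u) * u ^ (n + 1) * (N / u))
      (Set.Ioi 0) := by
    rw [MeasureTheory.integrableOn_congr_fun w2 measurableSet_Ioi]
    exact (momInt_integrable _ _).const_mul _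
  have i0 : MeasureTheory.IntegrableOn (fun u : ℝ => Real.exp (-u) * u ^ (n + 1) * 1)
      (Set.Ioi 0) := by
    rw [MeasureTheory.integrableOn_congr_fun w0 measurableSet_Ioi]
    exact momInt_integrable _ _
  have v1 : ∫ u in Set.Ioi (0 : ℝ), Real.exp (-u) * u ^ (n + 1) * (u / N)
      = (n + 1).factorial := by
    rw [MeasureTheory.setIntegral_congr_fun measurableSet_Ioi w1,
      MeasureTheory.integral_const_mul]
    have := momInt_zero_right (n + 2)
    unfold momInt at this
    rw [this, Nat.factorial_succ (n + 1), hN]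
    push_cast
    field_simp
  have v2 : ∫ u in Set.Ioi (0 : ℝ), Real.exp (-u) * u ^ (n + 1) * (N / u)
      = (n + 1).factorial + n.factorial := by
    rw [MeasureTheory.setIntegral_congr_fun measurableSet_Ioi w2,
      MeasureTheory.integral_const_mul]
    have := momInt_zero_right n
    unfold momInt at this
    rw [this, Nat.factorial_succ n, hN]
    push_cast
    ring
  have v0 : ∫ u in Set.Ioi (0 : ℝ), Real.exp (-u) * u ^ (n + 1) * 1
      = (n + 1).factorial := by
    rw [MeasureTheory.setIntegral_congr_fun measurableSet_Ioi w0]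
    exact momInt_zero_right (n + 1)
  have hexp : ∀ u ∈ Set.Ioi (0 : ℝ), Real.exp (Real.log u - Real.log N) = u / N ∧
      Real.exp (-(Real.log u - Real.log N)) = N / u := by
    intro u hu
    have hu' : 0 < u := hu
    constructor
    · rw [Real.exp_sub, Real.exp_log hu', Real.exp_log hNpos]
    · rw [neg_sub, Real.exp_sub, Real.exp_log hu', Real.exp_log hNpos]
  rcases Nat.lt_or_ge i 2 with h | h
  · have : i = 1 := by omega
    subst this
    have up : cenInt (n + 1) 1 ≤ 0 := by
      have : cenInt (n + 1) 1 ≤ ∫ u in Set.Ioi (0 : ℝ),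
          (Real.exp (-u) * u ^ (n + 1) * (u / N) - Real.exp (-u) * u ^ (n + 1) * 1) := by
        refine MeasureTheory.setIntegral_mono_on (cenInt_integrable _ _) (i1.sub i0)
          measurableSet_Ioi fun u hu => ?_
        have hu' : 0 < u := hu
        have h1 := Real.add_one_le_exp (Real.log u - Real.log N)
        rw [(hexp u hu).1] at h1
        rw [← mul_sub, pow_one]
        exact mul_le_mul_of_nonneg_left (by linarith) (by positivity)
      rw [MeasureTheory.integral_sub i1 i0, v1, v0] at this
      linarith
    have lo : -(n.factorial : ℝ) ≤ cenInt (n + 1) 1 := by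
      have : ∫ u in Set.Ioi (0 : ℝ),
          (Real.exp (-u) * u ^ (n + 1) * 1 - Real.exp (-u) * u ^ (n + 1) * (N / u))
          ≤ cenInt (n + 1) 1 := by
        refine MeasureTheory.setIntegral_mono_on (i0.sub i2) (cenInt_integrable _ _)
          measurableSet_Ioi fun u hu => ?_
        have hu' : 0 < u := hu
        have h1 := Real.add_one_le_exp (-(Real.log u - Real.log N))
        rw [(hexp u hu).2] at h1
        rw [← mul_sub, pow_one]
        exact mul_le_mul_of_nonneg_left (by linarith) (by positivity)
      rw [MeasureTheory.integral_sub i0 i2, v2, v0] at this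
      linarith
    rw [abs_le]
    constructor
    · simpa using lo
    · exact up.trans (by positivity)
  · have hb : |cenInt (n + 1) i| ≤ ∫ u in Set.Ioi (0 : ℝ), (i.factorial : ℝ) *
        ((Real.exp (-u) * u ^ (n + 1) * (u / N) + Real.exp (-u) * u ^ (n + 1) * (N / u))
          - 2 * (Real.exp (-u) * u ^ (n + 1) * 1)) := by
      have hInteg : MeasureTheory.IntegrableOn (fun u : ℝ => (i.factorial : ℝ) *
        ((Real.exp (-u) * u ^ (n + 1) * (u / N) + Real.exp (-u) * u ^ (n + 1) * (N / u))
          - 2 * (Real.exp (-u) * u ^ (n + 1) * 1))) (Set.Ioi 0) :=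
        ((i1.add i2).sub (i0.const_mul 2)).const_mul _
      rw [← Real.norm_eq_abs]
      unfold cenInt
      refine MeasureTheory.norm_integral_le_of_norm_le hInteg ?_
      filter_upwards [MeasureTheory.ae_restrict_mem measurableSet_Ioi] with u hu
      have hu' : 0 < u := hu
      have h1 := abs_pow_le_cosh i h (Real.log u - Real.log N)
      rw [(hexp u hu).1, (hexp u hu).2] at h1
      rw [Real.norm_eq_abs, abs_mul, abs_pow,
        abs_of_pos (by positivity : 0 < Real.exp (-u) * u ^ (n + 1))]
      refine (mul_le_mul_of_nonneg_left h1
        (by positivity : 0 ≤ Real.exp (-u) * u ^ (n + 1))).trans (le_of_eq ?_)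
      ring
    have e := MeasureTheory.integral_sub (i1.add i2) (i0.const_mul 2)
    have e2 := MeasureTheory.integral_add i1 i2
    simp only [Pi.add_apply] at e
    rw [MeasureTheory.integral_const_mul, e, e2, MeasureTheory.integral_const_mul, v0, v1, v2] at hb
    refine hb.trans (le_of_eq ?_)
    ring

lemma gMom_tendsto (j : ℕ) :
    Tendsto (fun m : ℕ => gMom m j - (Real.log (m + 1)) ^ j / j.factorial) atTop (nhds 0) := by
  have hterm : ∀ i ∈ Finset.range j, Tendsto (fun m : ℕ =>
      ((Real.log (m + 1) ^ (j - (i + 1)) * (j.choose (i + 1) : ℝ)) * cenInt m (i + 1))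
        / (m.factorial * j.factorial)) atTop (nhds 0) := by
    intro i _
    rw [← tendsto_add_atTop_iff_nat 1]
    have hl : Tendsto (fun n : ℕ => Real.log ((n : ℝ) + 2) ^ (j - (i + 1)) / ((n : ℝ) + 1))
        atTop (nhds 0) := by
      have h0 := Real.tendsto_pow_log_div_mul_add_atTop 1 (-1) (j - (i + 1)) one_ne_zero
      have h1 : Tendsto (fun n : ℕ => (n : ℝ) + 2) atTop atTop :=
        tendsto_atTop_add_const_right _ _ tendsto_natCast_atTop_atTop
      refine (h0.comp h1).congr fun n => ?_
      simp only [Function.comp]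
      congr 1
      ring
    refine squeeze_zero_norm (a := fun n : ℕ =>
      ((j.choose (i + 1) : ℝ) * (i + 1).factorial / j.factorial) *
        (Real.log ((n : ℝ) + 2) ^ (j - (i + 1)) / ((n : ℝ) + 1))) ?_
      (by simpa using hl.const_mul _)
    intro n
    have hb := cenInt_bound n (i + 1) (by omega)
    have hn2 : (((n + 1 : ℕ) : ℝ) + 1) = n + 2 := by push_cast; ring
    have hlog : 0 ≤ Real.log ((n : ℝ) + 2) := Real.log_nonneg (by
      linarith [(Nat.cast_nonneg n : (0 : ℝ) ≤ n)])
    rw [hn2, Real.norm_eq_abs, abs_div, abs_mul, abs_of_nonneg (by positivity :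
      0 ≤ Real.log ((n : ℝ) + 2) ^ (j - (i + 1)) * (j.choose (i + 1) : ℝ)),
      abs_of_pos (by positivity : (0 : ℝ) < (n + 1).factorial * j.factorial)]
    rw [div_le_iff₀ (by positivity)]
    refine (mul_le_mul_of_nonneg_left hb (by positivity)).trans (le_of_eq ?_)
    rw [Nat.factorial_succ n]
    push_cast
    have : (j.factorial : ℝ) ≠ 0 := by positivity
    field_simp
  have hsum := tendsto_finsetSum _ hterm
  simp only [Finset.sum_const_zero] at hsum
  refine hsum.congr fun m => ?_
  unfold gMom
  rw [momInt_eq_sum, Finset.sum_range_succ', cenInt_zero, add_div, Finset.sum_div]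
  have : (j.factorial : ℝ) ≠ 0 := by positivity
  have : (m.factorial : ℝ) ≠ 0 := by positivity
  simp
  field_simp
  ring
open PowerSeries in
lemma tuple_sum_eq (a : ℕ → ℝ) (ha : a 0 = 0) (k m : ℕ) :
    ∑ j ∈ (Fintype.piFinset fun _ : Fin k => Finset.Icc 1 m).filter
      (fun j => ∑ i, j i = m), ∏ i, a (j i) = coeff m ((PowerSeries.mk a) ^ k) := by
  have h1 : (PowerSeries.mk a) ^ k = ∏ _i : Fin k, PowerSeries.mk a := by simp
  rw [h1, PowerSeries.coeff_prod]
  simp only [coeff_mk]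
  have h2 : ∑ l ∈ Finset.finsuppAntidiag (Finset.univ : Finset (Fin k)) m,
      ∏ i, a (l i) = ∑ j ∈ Finset.piAntidiag (Finset.univ : Finset (Fin k)) m,
      ∏ i, a (j i) := by
    refine Finset.sum_bij (fun l _ => (l : Fin k → ℕ)) ?_ ?_ ?_ ?_
    · intro l hl
      simp [Finset.mem_finsuppAntidiag] at hl
      simpa using hl
    · intro l _ l' _ h
      exact DFunLike.coe_injective h
    · intro j hj
      refine ⟨Finsupp.equivFunOnFinite.symm j, ?_, by simp⟩
      simp [Finset.mem_finsuppAntidiag] at hj ⊢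
      exact hj
    · intro l _
      rfl
  rw [h2]
  refine Finset.sum_subset ?_ ?_
  · intro j hj
    simp at hj ⊢
    exact hj.2
  · intro j hj hj'
    simp only [Finset.mem_piAntidiag] at hj
    have hsum : ∑ i, j i = m := hj.1
    have : ∃ i, j i = 0 := by
      by_contra hc
      push Not at hc
      refine hj' ?_
      rw [Finset.mem_filter, Fintype.mem_piFinset]
      refine ⟨fun i => ?_, hsum⟩
      rw [Finset.mem_Icc]
      refine ⟨Nat.one_le_iff_ne_zero.mpr (hc i), ?_⟩
      rw [← hsum]
      exact Finset.single_le_sum (f := j) (fun _ _ => Nat.zero_le _) (Finset.mem_univ i)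
    obtain ⟨i, hi⟩ := this
    exact Finset.prod_eq_zero (Finset.mem_univ i) (by rw [hi, ha])

/-- The series `-log(1-X)`. -/
noncomputable def LSer : PowerSeries ℝ := PowerSeries.mk fun n => 1 / (n : ℝ)

/-- The series with coefficients `(ζ(2n)-1)/n`. -/
noncomputable def gSer : PowerSeries ℝ := PowerSeries.mk fun n => (zetaSum (2 * n) - 1) / (n : ℝ)

lemma Hsum_eq (k m : ℕ) : Hsum k m = PowerSeries.coeff m (LSer ^ k) :=
  tuple_sum_eq (fun n => 1 / (n : ℝ)) (by simp) k m

lemma Zsum_eq (k m : ℕ) : Zsum k m = PowerSeries.coeff m ((LSer + gSer) ^ k) := by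
  have h := tuple_sum_eq (fun n => zetaSum (2 * n) / (n : ℝ)) (by simp) k m
  have e : LSer + gSer = PowerSeries.mk fun n => zetaSum (2 * n) / (n : ℝ) := by
    ext n
    simp [LSer, gSer]
    ring
  rw [e]
  exact h

open PowerSeries in
lemma LSer_deriv : (1 - X) * derivative ℝ LSer = 1 := by
  have : derivative ℝ LSer = PowerSeries.mk 1 := by
    ext n
    rw [coeff_derivative]
    simp only [LSer, coeff_mk]
    push_cast
    have : (n + 1 : ℝ) ≠ 0 := by positivity
    simp [this]
  rw [this, mul_comm]
  exact PowerSeries.mk_one_mul_one_sub_eq_one ℝ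

open PowerSeries in
lemma LSer_rec (a m : ℕ) : ((m : ℝ) + 1) * coeff (m + 1) (LSer ^ (a + 1)) =
    m * coeff m (LSer ^ (a + 1)) + (a + 1) * coeff m (LSer ^ a) := by
  have h : (1 - X) * derivative ℝ (LSer ^ (a + 1)) = C ((a : ℝ) + 1) * LSer ^ a := by
    rw [derivative_pow]
    simp only [Nat.add_sub_cancel]
    have := LSer_deriv
    simp only [map_add, map_natCast, map_one]
    push_cast
    linear_combination ((a : PowerSeries ℝ) + 1) * LSer ^ a * this
  have h2 := congrArg (coeff m) h
  rw [sub_mul, one_mul, map_sub, coeff_derivative, coeff_C_mul] at h2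
  rcases m with _ | m
  · simp at h2 ⊢
    linarith
  · rw [coeff_succ_X_mul, coeff_derivative] at h2
    push_cast at h2 ⊢
    linarith

/-- Normalised coefficients. -/
noncomputable def pSer (m : ℕ) : PowerSeries ℝ := PowerSeries.mk fun j =>
  ((m : ℝ) + 1) * PowerSeries.coeff (m + 1) (LSer ^ (j + 1)) / (j + 1).factorial

noncomputable def gMomSer (m : ℕ) : PowerSeries ℝ := PowerSeries.mk (gMom m)

open PowerSeries in
lemma pSer_succ (m : ℕ) : pSer (m + 1) = pSer m * (1 + C (1 / ((m : ℝ) + 1)) * X) := by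
  ext j
  have : (m + 1 : ℝ) ≠ 0 := by positivity
  rw [mul_add, mul_one, map_add, ← mul_assoc]
  rcases j with _ | j
  · simp [pSer]
    have := LSer_rec 0 (m + 1)
    simp at this
    rw [this]
  · rw [coeff_succ_mul_X, coeff_mul_C]
    simp only [pSer, coeff_mk]
    have := LSer_rec (j + 1) (m + 1)
    rw [this, Nat.factorial_succ (j + 1)]
    have : ((j + 1).factorial : ℝ) ≠ 0 := by positivity
    push_cast
    have : (j + 1 + 1 : ℝ) ≠ 0 := by positivity
    field_simp

open PowerSeries in
lemma gMomSer_succ (m : ℕ) : gMomSer (m + 1) = gMomSer m * (1 + C (1 / ((m : ℝ) + 1)) * X) := by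
  ext j
  rw [mul_add, mul_one, map_add, ← mul_assoc]
  rcases j with _ | j
  · simp [gMomSer, gMom_zero_right]
  · rw [coeff_succ_mul_X, coeff_mul_C]
    simp only [gMomSer, coeff_mk]
    rw [gMom_succ]
    ring

open PowerSeries in
lemma pSer_zero : pSer 0 = 1 := by
  ext j
  rw [coeff_one]
  simp only [pSer, coeff_mk]
  have := LSer_rec j 0
  simp only [Nat.cast_zero, zero_mul, zero_add] at this ⊢
  rw [this]
  rcases j with _ | j
  · simp
  · simp [LSer]

open PowerSeries in
lemma pSer_eq (A : PowerSeries ℝ) (hA : A * gMomSer 0 = 1) (m : ℕ) : pSer m = A * gMomSer m := by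
  induction m with
  | zero => rw [hA, pSer_zero]
  | succ m ih => rw [pSer_succ, gMomSer_succ, ih, mul_assoc]

open PowerSeries in
lemma coeff_mul_range (f g : PowerSeries ℝ) (n : ℕ) :
    coeff n (f * g) = ∑ i ∈ Finset.range (n + 1), coeff i f * coeff (n - i) g := by
  rw [coeff_mul, Finset.Nat.sum_antidiagonal_eq_sum_range_succ_mk]

open PowerSeries in
lemma rec_series (A : ℕ → ℝ) (F : ℕ → ℝ) (h0 : A 0 = 1) (hF : F 0 = 1)
    (hA : ∀ j : ℕ, 1 ≤ j → ∑ i ∈ Finset.range (j + 1), A (j - i) * cGamma i = F j) :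
    PowerSeries.mk A * gMomSer 0 = PowerSeries.mk F := by
  ext j
  rw [mul_comm, coeff_mul_range]
  simp only [gMomSer, coeff_mk, ← cGamma_eq]
  rcases j with _ | j
  · simp [h0, hF, cGamma_eq, gMom_zero_right]
  · rw [← hA (j + 1) (by omega)]
    exact Finset.sum_congr rfl fun i _ => mul_comm _ _

/-- exponential series `exp (x X)`. -/
noncomputable def eSer (x : ℝ) : PowerSeries ℝ := PowerSeries.mk fun j => x ^ j / j.factorial

/-- The main asymptotics for `H`. -/
lemma main_H (A : PowerSeries ℝ) (hA : A * gMomSer 0 = 1) (k : ℕ) :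
    Tendsto (fun m : ℕ => (m : ℝ) / (k + 1).factorial * PowerSeries.coeff m (LSer ^ (k + 1))
      - PowerSeries.coeff k (A * eSer (Real.log m))) atTop (nhds 0) := by
  rw [← tendsto_add_atTop_iff_nat 1]
  have hterm : ∀ i ∈ Finset.range (k + 1), Tendsto (fun m : ℕ =>
      PowerSeries.coeff i A * (gMom m (k - i) -
        (Real.log (m + 1)) ^ (k - i) / (k - i).factorial)) atTop (nhds 0) := by
    intro i _
    simpa using (gMom_tendsto (k - i)).const_mul (PowerSeries.coeff i A)
  have hsum := tendsto_finsetSum _ hterm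
  simp only [Finset.sum_const_zero] at hsum
  refine hsum.congr fun m => ?_
  have h := congrArg (PowerSeries.coeff k) (pSer_eq A hA m)
  simp only [pSer, PowerSeries.coeff_mk] at h
  have h' : (((m + 1 : ℕ) : ℝ) / (k + 1).factorial * PowerSeries.coeff (m + 1) (LSer ^ (k + 1)))
      = PowerSeries.coeff k (A * gMomSer m) := by
    rw [← h]; push_cast; ring
  rw [h', coeff_mul_range, coeff_mul_range, ← Finset.sum_sub_distrib]
  refine Finset.sum_congr rfl fun i _ => ?_
  simp only [gMomSer, eSer, PowerSeries.coeff_mk]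
  push_cast
  ring
/-- `m * f m` has differences tending to zero. -/
def Slow (f : ℕ → ℝ) : Prop :=
  Tendsto (fun m : ℕ => ((m + 1 : ℕ) : ℝ) * f (m + 1) - (m : ℝ) * f m) atTop (nhds 0)

lemma Slow.tendsto {f : ℕ → ℝ} (h : Slow f) : Tendsto f atTop (nhds 0) := by
  have h1 := Filter.Tendsto.cesaro h
  refine h1.congr' ?_
  filter_upwards [eventually_ge_atTop 1] with n hn
  have := Finset.sum_range_sub (fun m : ℕ => (m : ℝ) * f m) n
  rw [this]
  have : (n : ℝ) ≠ 0 := by positivity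
  simp
  field_simp

lemma exists_abs_bound {u : ℕ → ℝ} (h : Tendsto u atTop (nhds 0)) :
    ∃ D : ℝ, 0 ≤ D ∧ ∀ n, |u n| ≤ D := by
  obtain ⟨D, hD⟩ := h.abs.bddAbove_range
  have : ∀ n, |u n| ≤ D := fun n => hD ⟨n, rfl⟩
  exact ⟨D, (abs_nonneg _).trans (this 0), this⟩

open PowerSeries in
lemma conv_lemma (g f : PowerSeries ℝ) (S : ℝ)
    (hg : Summable fun l : ℕ => (l : ℝ) * |coeff l g|)
    (hS : HasSum (fun l : ℕ => coeff l g) S)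
    (hf : Slow fun m => coeff m f) :
    Tendsto (fun m : ℕ => (m : ℝ) * coeff m (g * f) - S * ((m : ℝ) * coeff m f))
      atTop (nhds 0) := by
  set s : ℕ → ℝ := fun m => (m : ℝ) * coeff m f with hs
  have hf0 : Tendsto (fun m => coeff m f) atTop (nhds 0) := hf.tendsto
  obtain ⟨D, hD0, hD⟩ := exists_abs_bound hf
  obtain ⟨F, hF0, hF⟩ := exists_abs_bound hf0
  have hsl : ∀ l m : ℕ, |s (m + l) - s m| ≤ l * D := by
    intro l m
    induction l with
    | zero => simp
    | succ l ih =>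
      have h1 : |s (m + l + 1) - s (m + l)| ≤ D := hD (m + l)
      have h2 : s (m + (l + 1)) - s m = (s (m + l + 1) - s (m + l)) + (s (m + l) - s m) := by
        rw [← add_assoc]; ring
      rw [h2]
      refine (abs_add_le _ _).trans ?_
      push_cast
      linarith
  have hst : ∀ l : ℕ, Tendsto (fun m => s (m + l) - s m) atTop (nhds 0) := by
    intro l
    induction l with
    | zero => simp
    | succ l ih =>
      have h1 : Tendsto (fun m => s (m + l + 1) - s (m + l)) atTop (nhds 0) :=
        (tendsto_add_atTop_iff_nat l).mpr hf
      have := h1.add ih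
      rw [add_zero] at this
      refine this.congr fun m => ?_
      rw [← add_assoc]; ring
  have hs0 : s 0 = 0 := by simp [hs]
  have T := tendsto_tsum_of_dominated_convergence (𝓕 := (atTop : Filter ℕ))
    (f := fun m l : ℕ => (if l ≤ m then (m : ℝ) * (coeff l g * coeff (m - l) f) else 0)
      - coeff l g * s m) (g := fun _ => (0 : ℝ))
    (bound := fun l : ℕ => ((l : ℝ) * |coeff l g|) * (D + F)) (hg.mul_right _) ?_ ?_
  · rw [tsum_zero] at T
    refine T.congr fun m => ?_
    have hfin : HasSum (fun l : ℕ => if l ≤ m then (m : ℝ) * (coeff l g * coeff (m - l) f) else 0)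
        ((m : ℝ) * coeff m (g * f)) := by
      have : (m : ℝ) * coeff m (g * f) = ∑ l ∈ Finset.range (m + 1),
          (if l ≤ m then (m : ℝ) * (coeff l g * coeff (m - l) f) else 0) := by
        rw [coeff_mul_range, Finset.mul_sum]
        refine Finset.sum_congr rfl fun l hl => ?_
        rw [if_pos (by simpa [Nat.lt_succ_iff] using hl)]
      rw [this]
      refine hasSum_sum_of_ne_finset_zero fun l hl => ?_
      rw [if_neg]
      simpa [Nat.lt_succ_iff] using hl
    exact (hfin.sub (hS.mul_right (s m))).tsum_eq
  · intro l
    rw [← tendsto_add_atTop_iff_nat l]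
    have h1 := ((hst l).const_mul (-(coeff l g))).add (hf0.const_mul ((l : ℝ) * coeff l g))
    simp only [mul_zero, add_zero] at h1
    refine h1.congr fun m => ?_
    rw [if_pos (by omega), Nat.add_sub_cancel]
    simp only [hs]
    push_cast
    ring
  · refine Eventually.of_forall fun m l => ?_
    rw [Real.norm_eq_abs]
    split_ifs with h
    · obtain ⟨n, rfl⟩ := Nat.exists_eq_add_of_le' h
      rw [Nat.add_sub_cancel]
      have e : ((n + l : ℕ) : ℝ) * (coeff l g * coeff n f) - coeff l g * s (n + l)
          = -(coeff l g * (s (n + l) - s n)) + coeff l g * (l * coeff n f) := by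
        simp only [hs]; push_cast; ring
      rw [e]
      refine (abs_add_le _ _).trans ?_
      rw [abs_neg, abs_mul, abs_mul, abs_mul, Nat.abs_cast]
      have h1 := mul_le_mul_of_nonneg_left (hsl l n) (abs_nonneg (coeff l g))
      have h2 := mul_le_mul_of_nonneg_left
        (mul_le_mul_of_nonneg_left (hF n) (Nat.cast_nonneg l)) (abs_nonneg (coeff l g))
      linarith
    · rw [zero_sub, abs_neg, abs_mul]
      have h1 := hsl m 0
      rw [zero_add, hs0, sub_zero] at h1
      have h2 : (m : ℝ) ≤ l := by exact_mod_cast (not_le.mp h).le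
      have h3 : |s m| ≤ l * (D + F) := h1.trans (by
        have := mul_le_mul_of_nonneg_right h2 hD0
        have := mul_nonneg (Nat.cast_nonneg l : (0 : ℝ) ≤ l) hF0
        linarith)
      have := mul_le_mul_of_nonneg_left h3 (abs_nonneg (coeff l g))
      linarith

lemma slow_of_close {f f' : ℕ → ℝ} {S : ℝ} (hf : Slow f)
    (h : Tendsto (fun m : ℕ => (m : ℝ) * f' m - S * ((m : ℝ) * f m)) atTop (nhds 0)) :
    Slow f' := by
  have h1 := (tendsto_add_atTop_iff_nat 1).mpr h
  have h2 := (h1.sub h).add (Tendsto.const_mul S hf)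
  simp only [sub_zero, mul_zero, add_zero] at h2
  refine h2.congr fun m => ?_
  ring

open PowerSeries in
lemma conv_pow (g f : PowerSeries ℝ) (S : ℝ)
    (hg : Summable fun l : ℕ => (l : ℝ) * |coeff l g|)
    (hS : HasSum (fun l : ℕ => coeff l g) S)
    (hf : Slow fun m => coeff m f) (i : ℕ) :
    Tendsto (fun m : ℕ => (m : ℝ) * coeff m (g ^ i * f) - S ^ i * ((m : ℝ) * coeff m f))
      atTop (nhds 0) := by
  induction i with
  | zero => simp
  | succ i ih =>
    have h1 := conv_lemma g (g ^ i * f) S hg hS (slow_of_close hf ih)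
    have h2 := h1.add (ih.const_mul S)
    simp only [mul_zero, add_zero] at h2
    refine h2.congr fun m => ?_
    rw [← mul_assoc, ← pow_succ']
    ring

open PowerSeries in
lemma LSer_slow (a : ℕ) : Slow fun m => coeff m (LSer ^ a) := by
  induction a with
  | zero =>
    unfold Slow
    refine tendsto_const_nhds.congr' ?_
    filter_upwards [eventually_ge_atTop 1] with m hm
    have : m ≠ 0 := by omega
    simp [coeff_one, this]
  | succ a ih =>
    unfold Slow
    have := ih.tendsto.const_mul ((a : ℝ) + 1)
    rw [mul_zero] at this
    refine this.congr fun m => ?_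
    have := LSer_rec a m
    push_cast
    linarith

lemma xn_bounds (n : ℕ) : 0 ≤ 1 / ((n : ℝ) + 2) ^ 2 ∧ 1 / ((n : ℝ) + 2) ^ 2 ≤ 1 / 4 := by
  constructor
  · positivity
  · have : (0 : ℝ) ≤ n := Nat.cast_nonneg n
    apply one_div_le_one_div_of_le <;> nlinarith

lemma xn_summable : Summable fun n : ℕ => 1 / ((n : ℝ) + 2) ^ 2 := by
  have := (summable_nat_add_iff 2).mpr
    (Real.summable_one_div_nat_pow.mpr (by norm_num : 1 < 2))
  simpa using this

lemma double_summable :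
    Summable fun p : ℕ × ℕ => (1 / ((p.1 : ℝ) + 2) ^ 2) ^ (p.2 + 1) := by
  have hs : ∀ n : ℕ, HasSum (fun l : ℕ => (1 / ((n : ℝ) + 2) ^ 2) ^ (l + 1))
      ((1 - 1 / ((n : ℝ) + 2) ^ 2)⁻¹ * (1 / ((n : ℝ) + 2) ^ 2)) := by
    intro n
    have hx := xn_bounds n
    have := (hasSum_geometric_of_lt_one hx.1 (by linarith)).mul_right (1 / ((n : ℝ) + 2) ^ 2)
    simpa only [pow_succ] using this
  rw [summable_prod_of_nonneg]
  · refine ⟨fun n => (hs n).summable, ?_⟩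
    simp only [fun n => (hs n).tsum_eq]
    refine Summable.of_nonneg_of_le (fun n => ?_) (fun n => ?_) (xn_summable.mul_left 2)
    · have hx := xn_bounds n
      exact mul_nonneg (inv_nonneg.mpr (by linarith)) hx.1
    · have hx := xn_bounds n
      refine mul_le_mul_of_nonneg_right ?_ hx.1
      rw [inv_le_comm₀ (by linarith) (by norm_num)]
      linarith
  · intro p
    positivity

lemma zetaSum_sub_one (l : ℕ) :
    zetaSum (2 * (l + 1)) - 1 = ∑' n : ℕ, (1 / ((n : ℝ) + 2) ^ 2) ^ (l + 1) := by
  unfold zetaSum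
  have hsum : Summable fun n : ℕ => 1 / ((n : ℝ) + 1) ^ (2 * (l + 1)) := by
    have := (summable_nat_add_iff 1).mpr
      (Real.summable_one_div_nat_pow.mpr (by omega : 1 < 2 * (l + 1)))
    simpa using this
  rw [hsum.tsum_eq_zero_add]
  simp only [Nat.cast_zero, zero_add, one_pow, div_one, add_sub_cancel_left]
  refine tsum_congr fun n => ?_
  push_cast
  rw [div_pow, one_pow, ← pow_mul]
  ring_nf

open PowerSeries in
lemma gSer_summable : Summable fun l : ℕ => (l : ℝ) * |coeff l gSer| := by
  rw [← summable_nat_add_iff 1]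
  have h := double_summable.prod_symm.prod
  refine h.congr fun l => ?_
  simp only [gSer, coeff_mk]
  have hz := zetaSum_sub_one l
  have hnn : 0 ≤ zetaSum (2 * (l + 1)) - 1 := by
    rw [hz]; exact tsum_nonneg fun n => by positivity
  rw [abs_of_nonneg (by positivity), hz]
  have : ((l + 1 : ℕ) : ℝ) ≠ 0 := by positivity
  field_simp
  rfl

lemma log_hasSum : HasSum (fun n : ℕ => -Real.log (1 - 1 / ((n : ℝ) + 2) ^ 2)) (Real.log 2) := by
  rw [hasSum_iff_tendsto_nat_of_nonneg]
  · have hps : ∀ N : ℕ, ∑ n ∈ Finset.range N, -Real.log (1 - 1 / ((n : ℝ) + 2) ^ 2)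
        = Real.log 2 - Real.log (((N : ℝ) + 2) / ((N : ℝ) + 1)) := by
      intro N
      induction N with
      | zero => simp
      | succ N ih =>
        rw [Finset.sum_range_succ, ih]
        have e : (1 - 1 / ((N : ℝ) + 2) ^ 2) =
            ((((N + 1 : ℕ) : ℝ) + 2) / (((N + 1 : ℕ) : ℝ) + 1)) / (((N : ℝ) + 2) / ((N : ℝ) + 1)) := by
          push_cast
          have h1 : ((N : ℝ) + 2) ≠ 0 := by positivity
          have h2 : ((N : ℝ) + 1) ≠ 0 := by positivity
          have h3 : ((N : ℝ) + 1 + 1) ≠ 0 := by positivity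
          field_simp
          ring
        rw [e, Real.log_div (x := (((N + 1 : ℕ) : ℝ) + 2) / (((N + 1 : ℕ) : ℝ) + 1))
          (by positivity) (by positivity)]
        ring
    simp only [hps]
    have h1 : Tendsto (fun N : ℕ => ((N : ℝ) + 2) / ((N : ℝ) + 1)) atTop (nhds 1) := by
      have h2 := tendsto_one_div_add_atTop_nhds_zero_nat (𝕜 := ℝ)
      have h3 := h2.const_add 1
      rw [add_zero] at h3
      refine h3.congr fun N => ?_
      have h2 : ((N : ℝ) + 1) ≠ 0 := by positivity
      field_simp
      ring
    have h2 := (h1.log one_ne_zero).const_sub (Real.log 2)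
    simpa using h2
  · intro n
    have hx := xn_bounds n
    have := Real.log_nonpos (x := 1 - 1 / ((n : ℝ) + 2) ^ 2) (by linarith) (by linarith)
    linarith

open PowerSeries in
lemma gSer_hasSum : HasSum (fun l : ℕ => coeff l gSer) (Real.log 2) := by
  rw [← hasSum_nat_add_iff' 1]
  have h0 : Real.log 2 - ∑ i ∈ Finset.range 1, coeff i gSer = Real.log 2 := by simp [gSer]
  rw [h0]
  have hsum : Summable fun p : ℕ × ℕ => (1 / ((p.1 : ℝ) + 2) ^ 2) ^ (p.2 + 1) / ((p.2 : ℝ) + 1) := by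
    refine Summable.of_nonneg_of_le (fun p => by positivity) (fun p => ?_) double_summable
    refine div_le_self (by positivity) ?_
    linarith [(Nat.cast_nonneg p.2 : (0 : ℝ) ≤ p.2)]
  have hl : ∀ n : ℕ, HasSum (fun l : ℕ => (1 / ((n : ℝ) + 2) ^ 2) ^ (l + 1) / ((l : ℝ) + 1))
      (-Real.log (1 - 1 / ((n : ℝ) + 2) ^ 2)) := by
    intro n
    have hx := xn_bounds n
    exact Real.hasSum_pow_div_log_of_abs_lt_one (by rw [abs_of_nonneg hx.1]; linarith)
  have hcomm := hsum.hasSum.prod_fiberwise hl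
  have hval := hcomm.unique log_hasSum
  have hs2 := hsum.prod_symm
  have hs3 : HasSum (fun p : ℕ × ℕ => (1 / ((p.2 : ℝ) + 2) ^ 2) ^ (p.1 + 1) / ((p.1 : ℝ) + 1))
      (Real.log 2) := by
    rw [← hval]
    exact (Equiv.prodComm ℕ ℕ).hasSum_iff.mpr hsum.hasSum
  refine hs3.prod_fiberwise fun l => ?_
  have hh := (hs2.prod_factor l).hasSum
  have hv : coeff (l + 1) gSer =
      ∑' n : ℕ, (1 / ((n : ℝ) + 2) ^ 2) ^ (l + 1) / ((l : ℝ) + 1) := by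
    simp only [gSer, coeff_mk]
    rw [zetaSum_sub_one, ← tsum_div_const]
    push_cast
    rfl
  rw [hv]
  exact hh

open PowerSeries in
lemma main_Z (A : PowerSeries ℝ) (hA : A * gMomSer 0 = 1) (k : ℕ) :
    Tendsto (fun m : ℕ => (m : ℝ) / (k + 1).factorial * coeff m ((LSer + gSer) ^ (k + 1))
      - coeff k (A * eSer (Real.log 2) * eSer (Real.log m))) atTop (nhds 0) := by
  have h1 : ∀ i ∈ Finset.range (k + 2), Tendsto (fun m : ℕ =>
      (((k + 1).choose i : ℝ) / (k + 1).factorial) *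
        ((m : ℝ) * coeff m (gSer ^ (k + 1 - i) * LSer ^ i)
          - (Real.log 2) ^ (k + 1 - i) * ((m : ℝ) * coeff m (LSer ^ i)))) atTop (nhds 0) := by
    intro i _
    simpa using (conv_pow gSer (LSer ^ i) _ gSer_summable gSer_hasSum (LSer_slow i)
      (k + 1 - i)).const_mul (((k + 1).choose i : ℝ) / (k + 1).factorial)
  have h2 : ∀ i ∈ Finset.range (k + 1), Tendsto (fun m : ℕ =>
      ((Real.log 2) ^ (k - i) / (k - i).factorial) *
        ((m : ℝ) / (i + 1).factorial * coeff m (LSer ^ (i + 1))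
      - coeff i (A * eSer (Real.log m)))) atTop (nhds 0) := by
    intro i _
    simpa using (main_H A hA i).const_mul ((Real.log 2) ^ (k - i) / ((k - i).factorial : ℝ))
  have h := (tendsto_finsetSum _ h1).add (tendsto_finsetSum _ h2)
  simp only [Finset.sum_const_zero, add_zero] at h
  refine h.congr fun m => ?_
  have e1 : (m : ℝ) / (k + 1).factorial * coeff m ((LSer + gSer) ^ (k + 1)) =
      ∑ i ∈ Finset.range (k + 2), (((k + 1).choose i : ℝ) / (k + 1).factorial) *
        ((m : ℝ) * coeff m (gSer ^ (k + 1 - i) * LSer ^ i)) := by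
    rw [add_pow, map_sum, Finset.mul_sum]
    refine Finset.sum_congr rfl fun i _ => ?_
    have : LSer ^ i * gSer ^ (k + 1 - i) * ((k + 1).choose i : PowerSeries ℝ)
        = C ((k + 1).choose i : ℝ) * (gSer ^ (k + 1 - i) * LSer ^ i) := by
      rw [map_natCast]; ring
    rw [this, coeff_C_mul]
    ring
  have e2 : coeff k (A * eSer (Real.log 2) * eSer (Real.log m)) =
      ∑ i ∈ Finset.range (k + 1), ((Real.log 2) ^ (k - i) / (k - i).factorial) *
        coeff i (A * eSer (Real.log m)) := by
    have : A * eSer (Real.log 2) * eSer (Real.log m) =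
      (A * eSer (Real.log m)) * eSer (Real.log 2) := by ring
    rw [this, coeff_mul_range]
    refine Finset.sum_congr rfl fun i _ => ?_
    simp only [eSer, coeff_mk]
    ring
  have e3 : ∑ i ∈ Finset.range (k + 2), (((k + 1).choose i : ℝ) / (k + 1).factorial) *
        ((Real.log 2) ^ (k + 1 - i) * ((m : ℝ) * coeff m (LSer ^ i))) =
      ∑ i ∈ Finset.range (k + 1), ((Real.log 2) ^ (k - i) / (k - i).factorial) *
        ((m : ℝ) / (i + 1).factorial * coeff m (LSer ^ (i + 1))) := by
    rw [Finset.sum_range_succ']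
    have hz : (m : ℝ) * coeff m (LSer ^ 0) = 0 := by
      rw [pow_zero, coeff_one]
      split_ifs with h
      · simp [h]
      · simp
    rw [hz, mul_zero, mul_zero, add_zero]
    refine Finset.sum_congr rfl fun i hi => ?_
    have hi' : i + 1 ≤ k + 1 := by simpa [Nat.lt_succ_iff] using hi
    rw [Nat.cast_choose ℝ hi', Nat.add_sub_add_right]
    have a1 : ((k + 1).factorial : ℝ) ≠ 0 := by positivity
    have a2 : ((i + 1).factorial : ℝ) ≠ 0 := by positivity
    have a3 : ((k - i).factorial : ℝ) ≠ 0 := by positivity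
    field_simp
  simp only [mul_sub, Finset.sum_sub_distrib]
  rw [e1, e2, e3]
  ring

lemma final_sum (A : ℕ → ℝ) (k : ℕ) (x : ℝ) :
    ∑ j ∈ Finset.range (k + 1), A j / (Nat.factorial (k + 1 - 1 - j) : ℝ) * x ^ (k + 1 - 1 - j)
      = PowerSeries.coeff k (PowerSeries.mk A * eSer x) := by
  rw [coeff_mul_range]
  refine Finset.sum_congr rfl fun i _ => ?_
  simp only [eSer, PowerSeries.coeff_mk, Nat.add_sub_cancel]
  ring

/-- For a fixed integer `k ≥ 1` and the sequences `(A_j)`, `(B_j)` determined by `A₀ = B₀ = 1`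
and the recursions `∑_{i=0}^{j} A_{j−i} c_i = 0`, `∑_{i=0}^{j} B_{j−i} c_i = (log 2)^j/j!`
for `j ≥ 1`, as `m → ∞` one has
`(m/k!)·H_k(m) − ∑_{j=0}^{k−1} A_j (log m)^{k−1−j}/(k−1−j)! → 0` and
`(m/k!)·Z_k(m) − ∑_{j=0}^{k−1} B_j (log m)^{k−1−j}/(k−1−j)! → 0`. -/
theorem multiple_harmonic_sum_full_expansion (k : ℕ) (hk : 1 ≤ k) (A B : ℕ → ℝ)
    (hA0 : A 0 = 1) (hB0 : B 0 = 1)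
    (hA : ∀ j : ℕ, 1 ≤ j → ∑ i ∈ Finset.range (j + 1), A (j - i) * cGamma i = 0)
    (hB : ∀ j : ℕ, 1 ≤ j →
      ∑ i ∈ Finset.range (j + 1), B (j - i) * cGamma i =
        (Real.log 2) ^ j / (Nat.factorial j : ℝ)) :
    Filter.Tendsto
      (fun m : ℕ =>
        (m : ℝ) / (Nat.factorial k : ℝ) * Hsum k m -
          ∑ j ∈ Finset.range k,
            A j / (Nat.factorial (k - 1 - j) : ℝ) * (Real.log m) ^ (k - 1 - j))
      atTop (nhds 0) ∧
    Filter.Tendsto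
      (fun m : ℕ =>
        (m : ℝ) / (Nat.factorial k : ℝ) * Zsum k m -
          ∑ j ∈ Finset.range k,
            B j / (Nat.factorial (k - 1 - j) : ℝ) * (Real.log m) ^ (k - 1 - j))
      atTop (nhds 0) := by
  obtain ⟨k, rfl⟩ : ∃ n, k = n + 1 := ⟨k - 1, by omega⟩
  have sA : PowerSeries.mk A * gMomSer 0 = 1 := by
    rw [rec_series A (fun j => if j = 0 then 1 else 0) hA0 (by simp) (fun j hj => by
      rw [hA j hj, if_neg (by omega)])]
    ext j
    simp [PowerSeries.coeff_one]
  have sB : PowerSeries.mk B * gMomSer 0 = eSer (Real.log 2) :=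
    rec_series B (fun j => (Real.log 2) ^ j / (Nat.factorial j : ℝ)) hB0 (by simp) hB
  have sAB : PowerSeries.mk B = PowerSeries.mk A * eSer (Real.log 2) := by
    rw [← sB]
    linear_combination (-PowerSeries.mk B) * sA
  refine ⟨(main_H _ sA k).congr fun m => ?_, (main_Z _ sA k).congr fun m => ?_⟩
  · rw [Hsum_eq, final_sum]
  · rw [Zsum_eq, final_sum, sAB]
end

section
/- The following four series identities hold: ∑_{j=0}^{∞} A_j/2^j = 2/√π; ∑_{j=0}^{∞} B_j/2^j = 2·√(2/π); ∑_{j=1}^{∞} j·A_j/2^{j−1} = 2·(2·log 2 + γ − 2)/√π; and ∑_{j=1}^{∞} j·B_j/2^{j−1} = 2√2·(3·log 2 + γ − 2)/√π. -/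
lemma aux_abs_bound (u : ℝ) (hu : 0 < u) (r : ℝ) (_hr : 0 ≤ r) :
    Real.exp (-u) * Real.exp (r * |Real.log u|) ≤
      Real.exp (-u) * u ^ ((1 + r) - 1) + Real.exp (-u) * u ^ ((1 - r) - 1) := by
  rw [← mul_add]
  refine mul_le_mul_of_nonneg_left ?_ (Real.exp_pos _).le
  rw [Real.rpow_def_of_pos hu, Real.rpow_def_of_pos hu]
  rcases abs_cases (Real.log u) with ⟨h, _⟩ | ⟨h, _⟩
  · rw [h, show Real.log u * (1 + r - 1) = r * Real.log u by ring]
    linarith [Real.exp_pos (Real.log u * (1 - r - 1))]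
  · rw [h, show Real.log u * (1 - r - 1) = r * -Real.log u by ring]
    linarith [Real.exp_pos (Real.log u * (1 + r - 1))]

lemma hasSum_Gamma_one_add (z : ℂ) (hz : ‖z‖ < 1) :
    HasSum (fun n : ℕ => (cGamma n : ℂ) * z ^ n) (Complex.Gamma (1 + z)) := by
  have hre : 0 < (1 + z).re := by
    have := Complex.abs_re_le_norm z
    have := abs_le.1 this
    simp; linarith
  have key := MeasureTheory.hasSum_integral_of_dominated_convergence
    (μ := MeasureTheory.volume.restrict (Set.Ioi (0:ℝ)))
    (F := fun (n : ℕ) (u : ℝ) =>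
      ((Real.exp (-u) * Real.log u ^ n : ℝ) : ℂ) * (z ^ n / (n.factorial : ℂ)))
    (f := fun u : ℝ => ((Real.exp (-u) : ℝ) : ℂ) * (u : ℂ) ^ ((1 + z) - 1))
    (fun n u => Real.exp (-u) * ((‖z‖ * |Real.log u|) ^ n / n.factorial))
    ?_ ?_ ?_ ?_ ?_
  · rw [Complex.Gamma_eq_integral hre, Complex.GammaIntegral]
    convert! key using 1
    funext n
    rw [MeasureTheory.integral_mul_const, integral_complex_ofReal, cGamma]
    push_cast
    ring
  · intro n
    refine Measurable.aestronglyMeasurable ?_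
    fun_prop
  · intro n
    refine Filter.Eventually.of_forall fun u => le_of_eq ?_
    rw [norm_mul, norm_div, norm_pow, Complex.norm_real, norm_mul, norm_pow, mul_pow]
    simp [abs_of_pos (Real.exp_pos _)]
    ring
  · refine Filter.Eventually.of_forall fun u => ?_
    exact (Real.summable_pow_div_factorial _).mul_left _
  · have : (fun u : ℝ => ∑' n : ℕ, Real.exp (-u) * ((‖z‖ * |Real.log u|) ^ n / n.factorial)) =
        fun u => Real.exp (-u) * Real.exp (‖z‖ * |Real.log u|) := by
      funext u
      rw [tsum_mul_left, Real.exp_eq_exp_ℝ, NormedSpace.exp_eq_tsum_div]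
    rw [this]
    have h1 := Real.GammaIntegral_convergent (s := 1 + ‖z‖) (by positivity)
    have h2 := Real.GammaIntegral_convergent (s := 1 - ‖z‖) (by linarith)
    refine MeasureTheory.Integrable.mono' (h1.add h2) ?_ ?_
    · refine Measurable.aestronglyMeasurable ?_
      fun_prop
    · filter_upwards [MeasureTheory.ae_restrict_mem measurableSet_Ioi] with u hu
      rw [Real.norm_of_nonneg (by positivity)]
      exact aux_abs_bound u hu _ (norm_nonneg _)
  · filter_upwards [MeasureTheory.ae_restrict_mem measurableSet_Ioi] with u hu
    have hu0 : (u : ℂ) ≠ 0 := by exact_mod_cast (ne_of_gt hu)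
    rw [add_sub_cancel_left, Complex.cpow_def_of_ne_zero hu0, ← Complex.ofReal_log (le_of_lt hu)]
    have := (NormedSpace.expSeries_div_hasSum_exp (𝔸 := ℂ) ((Real.log u : ℂ) * z)).mul_left
      ((Real.exp (-u) : ℝ) : ℂ)
    rw [← Complex.exp_eq_exp_ℂ] at this
    convert! this using 1
    funext n
    push_cast
    rw [mul_pow]
    ring

lemma iteratedDeriv_Gamma_one_add (n : ℕ) :
    iteratedDeriv n (fun z : ℂ => Complex.Gamma (1 + z)) 0 = n.factorial * cGamma n := by
  have hd : DifferentiableOn ℂ (fun z : ℂ => Complex.Gamma (1 + z)) (Metric.ball 0 1) := by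
    intro z hz
    have hz' : ‖z‖ < 1 := by simpa using hz
    refine DifferentiableAt.differentiableWithinAt ?_
    refine DifferentiableAt.comp (g := Complex.Gamma) z
      (Complex.differentiableAt_Gamma _ ?_) (by fun_prop)
    intro m h
    have h1 := congrArg Complex.re h
    have := abs_le.1 (Complex.abs_re_le_norm z)
    simp at h1
    have : (0:ℝ) ≤ m := Nat.cast_nonneg m
    linarith
  have hball : ∀ᶠ z in nhds (0:ℂ), z ∈ Metric.ball (0:ℂ) 1 := Metric.ball_mem_nhds _ one_pos
  have h1 : HasFPowerSeriesAt (fun z : ℂ => Complex.Gamma (1 + z))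
      (FormalMultilinearSeries.ofScalars ℂ (fun n => (cGamma n : ℂ))) 0 := by
    rw [hasFPowerSeriesAt_iff']
    filter_upwards [hball] with z hz
    have := hasSum_Gamma_one_add z (by simpa using hz)
    simpa [FormalMultilinearSeries.coeff_ofScalars, mul_comm] using this
  have h2 : HasFPowerSeriesAt (fun z : ℂ => Complex.Gamma (1 + z))
      (FormalMultilinearSeries.ofScalars ℂ (fun n => ((n.factorial : ℂ)⁻¹ *
        iteratedDeriv n (fun z : ℂ => Complex.Gamma (1 + z)) 0))) 0 := by
    rw [hasFPowerSeriesAt_iff']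
    filter_upwards [hball] with z hz
    have := Complex.hasSum_taylorSeries_on_ball hd hz
    simp only [FormalMultilinearSeries.coeff_ofScalars, smul_eq_mul] at this ⊢
    convert! this using 2
    ring
  have h3 := congrArg (fun p => FormalMultilinearSeries.coeff p n)
    (h1.eq_formalMultilinearSeries h2)
  simp only [FormalMultilinearSeries.coeff_ofScalars] at h3
  rw [h3, ← mul_assoc, mul_inv_cancel₀ (by exact_mod_cast n.factorial_ne_zero), one_mul]

/-- The entire function `exp (L z) / Γ(1+z)`. -/
noncomputable def genF (L : ℝ) (z : ℂ) : ℂ := Complex.exp (L * z) * (Complex.Gamma (1 + z))⁻¹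

lemma differentiable_genF (L : ℝ) : Differentiable ℂ (genF L) := by
  unfold genF
  refine Differentiable.mul (by fun_prop) ?_
  exact Complex.differentiable_one_div_Gamma.comp (by fun_prop : Differentiable ℂ fun z : ℂ => 1 + z)

lemma cGamma_zero : cGamma 0 = 1 := by
  have := iteratedDeriv_Gamma_one_add 0
  simp at this
  exact_mod_cast this.symm

lemma genF_rec (L : ℝ) (n : ℕ) :
    ∑ i ∈ Finset.range (n + 1),
      (iteratedDeriv (n - i) (genF L) 0 / ((n - i).factorial : ℂ)) * cGamma i
      = (L : ℂ) ^ n / n.factorial := by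
  have hG : AnalyticAt ℂ (fun z : ℂ => Complex.Gamma (1 + z)) 0 := by
    rw [Complex.analyticAt_iff_eventually_differentiableAt]
    filter_upwards [Metric.ball_mem_nhds (0:ℂ) one_pos] with z hz
    have hz' : ‖z‖ < 1 := by simpa using hz
    refine DifferentiableAt.comp (g := Complex.Gamma) z
      (Complex.differentiableAt_Gamma _ ?_) (by fun_prop)
    intro m h
    have h1 := congrArg Complex.re h
    have := abs_le.1 (Complex.abs_re_le_norm z)
    simp at h1
    have : (0:ℝ) ≤ m := Nat.cast_nonneg m
    linarith
  have hF : ContDiffAt ℂ n (genF L) 0 := (differentiable_genF L).contDiff.contDiffAt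
  have hprod : (fun z => Complex.Gamma (1 + z)) * genF L =ᶠ[nhds 0]
      fun z : ℂ => Complex.exp (L * z) := by
    filter_upwards [Metric.ball_mem_nhds (0:ℂ) one_pos] with z hz
    have hz' : ‖z‖ < 1 := by simpa using hz
    have : Complex.Gamma (1 + z) ≠ 0 := by
      apply Complex.Gamma_ne_zero_of_re_pos
      have := abs_le.1 (Complex.abs_re_le_norm z)
      simp; linarith
    simp only [Pi.mul_apply, genF]
    field_simp
  have h1 := hprod.iteratedDeriv_eq n
  rw [iteratedDeriv_mul hG.contDiffAt hF, iteratedDeriv_cexp_const_mul] at h1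
  simp only [mul_zero, Complex.exp_zero, mul_one, iteratedDeriv_Gamma_one_add] at h1
  rw [← h1, Finset.sum_div]
  refine Finset.sum_congr rfl fun i hi => ?_
  have hi' : i ≤ n := by simp at hi; omega
  rw [Nat.cast_choose _ hi']
  have := n.factorial_ne_zero
  have := i.factorial_ne_zero
  have := (n - i).factorial_ne_zero
  field_simp

lemma coeff_eq (L : ℝ) (X : ℕ → ℝ)
    (hX : ∀ j : ℕ, ∑ i ∈ Finset.range (j + 1), X (j - i) * cGamma i = L ^ j / (j.factorial : ℝ))
    (n : ℕ) : iteratedDeriv n (genF L) 0 / (n.factorial : ℂ) = X n := by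
  induction n using Nat.strong_induction_on with
  | _ n ih =>
    have h1 := genF_rec L n
    have h2 : ((∑ i ∈ Finset.range (n + 1), X (n - i) * cGamma i : ℝ) : ℂ) =
      ((L ^ n / (n.factorial : ℝ) : ℝ) : ℂ) := by rw [hX n]
    push_cast at h2
    rw [← h2, Finset.sum_range_succ', Finset.sum_range_succ'] at h1
    have h3 : ∑ k ∈ Finset.range n, (iteratedDeriv (n - (k + 1)) (genF L) 0 /
        ((n - (k + 1)).factorial : ℂ)) * (cGamma (k + 1) : ℂ) =
        ∑ k ∈ Finset.range n, (X (n - (k + 1)) : ℂ) * (cGamma (k + 1) : ℂ) := by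
      refine Finset.sum_congr rfl fun k hk => ?_
      rw [ih (n - (k + 1)) (by simp at hk; omega)]
    rw [h3] at h1
    simpa [cGamma_zero] using h1

lemma main_aux (L : ℝ) (X : ℕ → ℝ)
    (hX : ∀ j : ℕ, ∑ i ∈ Finset.range (j + 1), X (j - i) * cGamma i = L ^ j / (j.factorial : ℝ)) :
    HasSum (fun j : ℕ => X j / 2 ^ j) (Real.exp (L / 2) * (2 / Real.sqrt Real.pi)) ∧
    HasSum (fun j : ℕ => (j : ℝ) * X j / 2 ^ (j - 1))
      (Real.exp (L / 2) * (2 / Real.sqrt Real.pi) *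
        (L + 2 * Real.log 2 + Real.eulerMascheroniConstant - 2)) := by
  have hGam : Complex.Gamma (1 + 1 / 2) = ((Real.sqrt Real.pi / 2 : ℝ) : ℂ) := by
    rw [add_comm, Complex.Gamma_add_one _ (by norm_num)]
    have := Complex.Gamma_ofReal (1 / 2)
    rw [Real.Gamma_one_half_eq] at this
    push_cast at this ⊢
    rw [this]; ring
  have hpi : (Real.sqrt Real.pi) ≠ 0 := by positivity
  have hv : genF L (1 / 2) = ((Real.exp (L / 2) * (2 / Real.sqrt Real.pi) : ℝ) : ℂ) := by
    rw [genF, hGam]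
    push_cast
    rw [inv_div]
    ring_nf
  have hdG : HasDerivAt (fun z : ℂ => Complex.Gamma (1 + z))
      ((Real.sqrt Real.pi / 2 * (2 - 2 * Real.log 2 - Real.eulerMascheroniConstant) : ℝ) : ℂ)
      (1 / 2) := by
    have hne : (1 / 2 : ℂ) ≠ 0 := by norm_num
    have h1 := (hasDerivAt_id (1 / 2 : ℂ)).mul Complex.hasDerivAt_Gamma_one_half
    have h2 : (fun z : ℂ => Complex.Gamma (1 + z)) =ᶠ[nhds (1 / 2)] id * Complex.Gamma := by
      filter_upwards [isOpen_ne.mem_nhds hne] with z hz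
      rw [add_comm, Complex.Gamma_add_one _ hz]; rfl
    refine (h1.congr_of_eventuallyEq h2).congr_deriv ?_
    have := Complex.Gamma_ofReal (1 / 2)
    rw [Real.Gamma_one_half_eq] at this
    push_cast at this ⊢
    rw [this, Complex.ofReal_log two_pos.le]
    simp only [id]
    push_cast
    ring
  have hdv : deriv (genF L) (1 / 2) = ((Real.exp (L / 2) * (2 / Real.sqrt Real.pi) *
        (L + 2 * Real.log 2 + Real.eulerMascheroniConstant - 2) : ℝ) : ℂ) := by
    have hne : Complex.Gamma (1 + 1 / 2) ≠ 0 := by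
      rw [hGam]; exact_mod_cast (by positivity : Real.sqrt Real.pi / 2 ≠ 0)
    have he : HasDerivAt (fun z : ℂ => Complex.exp (L * z)) (Complex.exp (L * (1 / 2)) * L)
        (1 / 2) := by
      have := ((hasDerivAt_id (1 / 2 : ℂ)).const_mul (L : ℂ)).cexp
      simpa using this
    have h := (he.mul (hdG.inv hne)).deriv
    have hfun : genF L = (fun z : ℂ => Complex.exp (L * z)) * 
       (fun z : ℂ => Complex.Gamma (1 + z))⁻¹ := rfl
    rw [hfun, h, Pi.inv_apply, hGam]
    have hpi' : ((Real.sqrt Real.pi : ℝ) : ℂ) ≠ 0 := by exact_mod_cast hpi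
    rw [show (L : ℂ) * (1 / 2) = L / 2 by ring]
    push_cast
    field_simp
    ring
  have hc := coeff_eq L X hX
  constructor
  · have h := Complex.hasSum_taylorSeries_of_entire (differentiable_genF L) 0 (1 / 2)
    rw [hv] at h
    rw [← Complex.hasSum_ofReal]
    convert! h using 1
    funext n
    simp only [Function.comp, smul_eq_mul]
    push_cast
    rw [← hc n]
    simp
    ring
  · have hdd : Differentiable ℂ (deriv (genF L)) := by
      intro z
      exact ((differentiable_genF L).analyticAt z).deriv.differentiableAt
    have h := Complex.hasSum_taylorSeries_of_entire hdd 0 (1 / 2)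
    rw [hdv] at h
    rw [← hasSum_nat_add_iff' 1]
    simp only [Finset.range_one, Finset.sum_singleton, Nat.cast_zero, zero_mul, zero_div, sub_zero]
    rw [← Complex.hasSum_ofReal]
    convert! h using 1
    funext n
    simp only [Function.comp, smul_eq_mul]
    rw [← iteratedDeriv_succ']
    push_cast
    rw [← hc (n + 1), Nat.factorial_succ]
    have : (n : ℂ) + 1 ≠ 0 := by exact_mod_cast n.succ_ne_zero
    have := n.factorial_ne_zero
    simp
    field_simp



/-- For the sequences `(A_j)`, `(B_j)` determined by `A₀ = B₀ = 1` and the recursions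
`∑_{i=0}^{j} A_{j−i} c_i = 0`, `∑_{i=0}^{j} B_{j−i} c_i = (log 2)^j/j!` for `j ≥ 1`:
`∑_{j≥0} A_j/2^j = 2/√π`, `∑_{j≥0} B_j/2^j = 2√(2/π)`,
`∑_{j≥1} j·A_j/2^{j−1} = 2(2 log 2 + γ − 2)/√π`, and
`∑_{j≥1} j·B_j/2^{j−1} = 2√2(3 log 2 + γ − 2)/√π`. -/
theorem series_values_of_A_B (A B : ℕ → ℝ)
    (hA0 : A 0 = 1) (hB0 : B 0 = 1)
    (hA : ∀ j : ℕ, 1 ≤ j → ∑ i ∈ Finset.range (j + 1), A (j - i) * cGamma i = 0)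
    (hB : ∀ j : ℕ, 1 ≤ j →
      ∑ i ∈ Finset.range (j + 1), B (j - i) * cGamma i =
        (Real.log 2) ^ j / (Nat.factorial j : ℝ)) :
    HasSum (fun j : ℕ => A j / 2 ^ j) (2 / Real.sqrt Real.pi) ∧
    HasSum (fun j : ℕ => B j / 2 ^ j) (2 * Real.sqrt (2 / Real.pi)) ∧
    HasSum (fun j : ℕ => (j : ℝ) * A j / 2 ^ (j - 1))
      (2 * (2 * Real.log 2 + Real.eulerMascheroniConstant - 2) / Real.sqrt Real.pi) ∧
    HasSum (fun j : ℕ => (j : ℝ) * B j / 2 ^ (j - 1))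
      (2 * Real.sqrt 2 * (3 * Real.log 2 + Real.eulerMascheroniConstant - 2) /
        Real.sqrt Real.pi) := by
  have h1 := main_aux 0 A (by
    intro j
    rcases Nat.eq_zero_or_pos j with rfl | hj
    · simp [hA0, cGamma_zero]
    · rw [hA j hj, zero_pow hj.ne', zero_div])
  have h2 := main_aux (Real.log 2) B (by
    intro j
    rcases Nat.eq_zero_or_pos j with rfl | hj
    · simp [hB0, cGamma_zero]
    · exact hB j hj)
  have he : Real.exp (Real.log 2 / 2) = Real.sqrt 2 := by
    rw [Real.sqrt_eq_rpow, Real.rpow_def_of_pos two_pos]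
    ring_nf
  rw [he] at h2
  refine ⟨?_, ?_, ?_, ?_⟩
  · convert! h1.1 using 1
    simp
  · convert! h2.1 using 1
    rw [Real.sqrt_div two_pos.le]
    ring
  · convert! h1.2 using 1
    simp
    ring
  · convert! h2.2 using 1
    ring
end

section
/- Let k ≥ 1 be an integer, let L be an additive subgroup of ℤ^k of finite index d = [ℤ^k : L], and let m₁,…,m_k be positive integers with |m| = m₁+⋯+m_k. Then: (i) lim_{N→∞} (1/N^{|m|+k}) · ∑ b₁^{m₁}⋯b_k^{m_k} = (1/d)·(1/(|m|+k)!)·∏_{i=1}^{k} ( m_i!·ζ(m_i+1) ), where the sum ranges over all pairs of k-tuples b = (b₁,…,b_k) and H = (H₁,…,H_k) of positive integers such that b₁H₁+⋯+b_kH_k ≤ N and b ∈ L; and (ii) for every fixed k-tuple H of positive integers, lim_{N→∞} (1/N^{|m|+k}) · ∑_{b: b·H ≤ N, b ∈ L} b₁^{m₁}⋯b_k^{m_k} = (1/d)·(1/(|m|+k)!)·∏_{i=1}^{k} ( m_i!/H_i^{m_i+1} ). -/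
open Filter
open scoped Classical

/-- The sum `∑ b₁^{m₁}⋯b_k^{m_k}` over all pairs of `k`-tuples `b`, `H` of positive
integers with `b⋅H ≤ N` and `b ∈ L`. (Since all entries are at least `1` and
`b⋅H ≤ N`, every entry lies in `[1, N]`, so the sum below captures exactly these pairs.) -/
noncomputable def latticeSum (k : ℕ) (L : AddSubgroup (Fin k → ℤ)) (m : Fin k → ℕ)
    (N : ℕ) : ℝ :=
  ∑ b ∈ Fintype.piFinset (fun _ : Fin k => Finset.Icc 1 N),
    ∑ H ∈ Fintype.piFinset (fun _ : Fin k => Finset.Icc 1 N),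
      if (∑ i, b i * H i ≤ N) ∧ ((fun i => (b i : ℤ)) ∈ L) then
        ∏ i, (b i : ℝ) ^ (m i)
      else 0

/-- The sum `∑ b₁^{m₁}⋯b_k^{m_k}` over all `k`-tuples `b` of positive integers with
`b⋅H ≤ N` and `b ∈ L`, for a fixed tuple `H` of positive integers. -/
noncomputable def latticeSumFixed (k : ℕ) (L : AddSubgroup (Fin k → ℤ)) (m H : Fin k → ℕ)
    (N : ℕ) : ℝ :=
  ∑ b ∈ Fintype.piFinset (fun _ : Fin k => Finset.Icc 1 N),
    if (∑ i, b i * H i ≤ N) ∧ ((fun i => (b i : ℤ)) ∈ L) then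
      ∏ i, (b i : ℝ) ^ (m i)
    else 0


/-- Error lemma. -/
lemma conv_error (a e : ℕ → ℝ) (ha : ∀ n, 0 ≤ a n) (p q : ℕ) (hq : 1 ≤ q) (c : ℝ)
    (hA : Tendsto (fun N : ℕ => (∑ n ∈ Finset.range (N + 1), a n) / (N : ℝ) ^ p) atTop (nhds c))
    (he : Tendsto (fun N : ℕ => e N / (N : ℝ) ^ q) atTop (nhds 0)) :
    Tendsto (fun N : ℕ => (∑ n ∈ Finset.range (N + 1), a n * e (N - n)) / (N : ℝ) ^ (p + q))
      atTop (nhds 0) := by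
  have hc : 0 ≤ c := ge_of_tendsto' hA (fun N => div_nonneg (Finset.sum_nonneg fun n _ => ha n)
    (by positivity))
  rw [Metric.tendsto_atTop]
  intro ε hε
  set δ : ℝ := ε / (c + 2) with hδ
  have hδ0 : 0 < δ := by positivity
  obtain ⟨n0, hn0⟩ := Metric.tendsto_atTop.1 he δ hδ0
  set K : ℝ := ∑ n ∈ Finset.range (n0 + 1), |e n| with hK
  have hK0 : 0 ≤ K := Finset.sum_nonneg fun n _ => abs_nonneg _
  have hbd : ∀ n, |e n| ≤ δ * (n : ℝ) ^ q + K := by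
    intro n
    by_cases hn : n ≤ n0
    · have : |e n| ≤ K := Finset.single_le_sum (f := fun n => |e n|) (fun n _ => abs_nonneg _)
        (Finset.mem_range.2 (by omega))
      have : 0 ≤ δ * (n : ℝ) ^ q := by positivity
      linarith
    · have h1 := hn0 n (by omega)
      have hpos : (0 : ℝ) < (n : ℝ) ^ q := by
        have : (0 : ℝ) < n := by exact_mod_cast (by omega : 0 < n)
        positivity
      rw [dist_zero_right, Real.norm_eq_abs, abs_div, abs_of_pos hpos, div_lt_iff₀ hpos] at h1
      linarith
  have hlim : Tendsto (fun N : ℕ => (δ + K / (N : ℝ) ^ q) *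
      ((∑ n ∈ Finset.range (N + 1), a n) / (N : ℝ) ^ p)) atTop (nhds ((δ + 0) * c)) := by
    refine Tendsto.mul (Tendsto.add tendsto_const_nhds ?_) hA
    refine Tendsto.div_atTop tendsto_const_nhds ?_
    exact (tendsto_pow_atTop (by omega)).comp tendsto_natCast_atTop_atTop
  have hlt : (δ + 0) * c < ε := by
    rw [add_zero, hδ, div_mul_eq_mul_div, div_lt_iff₀ (by positivity)]
    nlinarith
  obtain ⟨N1, hN1⟩ := eventually_atTop.1 (hlim.eventually_lt_const hlt)
  refine ⟨max N1 1, fun N hN => ?_⟩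
  have h2 := hN1 N (le_trans (le_max_left _ _) hN)
  have hNpos : (0 : ℝ) < N := by exact_mod_cast (lt_of_lt_of_le one_pos (le_trans (le_max_right _ _) hN))
  rw [dist_zero_right, Real.norm_eq_abs, abs_div, abs_of_pos (by positivity : (0 : ℝ) < (N : ℝ) ^ (p + q))]
  refine lt_of_le_of_lt ?_ h2
  have h3 : |∑ n ∈ Finset.range (N + 1), a n * e (N - n)| ≤
      (δ * (N : ℝ) ^ q + K) * ∑ n ∈ Finset.range (N + 1), a n := by
    refine (Finset.abs_sum_le_sum_abs _ _).trans ?_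
    rw [Finset.mul_sum]
    refine Finset.sum_le_sum fun n _ => ?_
    rw [abs_mul, abs_of_nonneg (ha n), mul_comm]
    refine mul_le_mul_of_nonneg_right ((hbd _).trans ?_) (ha n)
    have : ((N - n : ℕ) : ℝ) ≤ N := by exact_mod_cast Nat.sub_le _ _
    gcongr
  rw [div_le_iff₀ (by positivity)]
  refine h3.trans (le_of_eq ?_)
  field_simp
  ring

lemma choose_asym (p : ℕ) :
    Tendsto (fun N : ℕ => ((N + p).choose p : ℝ) / (N : ℝ) ^ p) atTop
      (nhds (1 / (p.factorial : ℝ))) := by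
  have h1 : Tendsto (fun N : ℕ => (N.choose p : ℝ) / ((N : ℝ) ^ p / p.factorial)) atTop (nhds 1) := by
    refine (Asymptotics.isEquivalent_iff_tendsto_one ?_).1 (isEquivalent_choose p)
    filter_upwards [eventually_gt_atTop 0] with N hN
    have : (0 : ℝ) < N := by exact_mod_cast hN
    positivity
  have h2 := h1.comp (tendsto_add_atTop_nat p)
  have h3 : Tendsto (fun N : ℕ => (1 + (p : ℝ) / N) ^ p / (p.factorial : ℝ)) atTop
      (nhds ((1 + 0) ^ p / p.factorial)) := by
    refine Tendsto.div_const (Tendsto.pow (Tendsto.add tendsto_const_nhds ?_) _) _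
    exact tendsto_const_div_atTop_nhds_zero_nat _
  have h4 := h2.mul h3
  rw [add_zero, one_pow, one_mul] at h4
  refine h4.congr' ?_
  filter_upwards [eventually_gt_atTop 0] with N hN
  have : (0 : ℝ) < N := by exact_mod_cast hN
  have h5 : (0 : ℝ) < (N : ℝ) + p := by positivity
  simp only [Function.comp, Nat.cast_add]
  rw [show (1 + (p : ℝ) / N) = (N + p) / N by field_simp, div_pow]
  field_simp

lemma err_tendsto (F : ℕ → ℝ) (q : ℕ) (β : ℝ)
    (hF : Tendsto (fun N : ℕ => F N / (N : ℝ) ^ q) atTop (nhds (β / q.factorial))) :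
    Tendsto (fun N : ℕ => (F N - β * ((N + q).choose q : ℝ)) / (N : ℝ) ^ q) atTop (nhds 0) := by
  have := hF.sub ((choose_asym q).const_mul β)
  rw [mul_one_div, sub_self] at this
  refine this.congr fun N => ?_
  rw [sub_div, mul_div_assoc]

lemma cesaro (A : ℕ → ℝ) (p : ℕ) (hp : 1 ≤ p) (α : ℝ)
    (hA : Tendsto (fun N : ℕ => A N / (N : ℝ) ^ p) atTop (nhds (α / p.factorial))) :
    Tendsto (fun N : ℕ => (∑ n ∈ Finset.range (N + 1), A n) / (N : ℝ) ^ (p + 1)) atTop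
      (nhds (α / (p + 1).factorial)) := by
  have h1 := conv_error (fun _ => 1) (fun N => A N - α * ((N + p).choose p : ℝ)) (by simp) 1 p hp 1
    (by
      have h : Tendsto (fun N : ℕ => 1 + 1 / (N : ℝ)) atTop (nhds (1 + 0)) :=
        Tendsto.add tendsto_const_nhds (tendsto_const_div_atTop_nhds_zero_nat _)
      rw [add_zero] at h
      refine h.congr' ?_
      filter_upwards [eventually_gt_atTop 0] with N hN
      have : (0 : ℝ) < N := by exact_mod_cast hN
      simp
      field_simp)
    (err_tendsto A p α hA)
  have h2 := h1.add ((choose_asym (p + 1)).const_mul α)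
  rw [mul_one_div, zero_add] at h2
  refine h2.congr fun N => ?_
  rw [add_comm 1 p, mul_div_assoc', ← add_div]
  congr 1
  simp only [one_mul]
  have h3 := Finset.sum_range_reflect (fun n => A n - α * ((n + p).choose p : ℝ)) (N + 1)
  simp only [add_tsub_cancel_right] at h3
  have h4 : ∀ n ∈ Finset.range (N + 1), N + 1 - 1 - n = N - n := fun n _ => by omega
  rw [h3, Finset.sum_sub_distrib, ← Finset.mul_sum]
  have h5 : ∑ n ∈ Finset.range (N + 1), ((n + p).choose p : ℝ) = ((N + (p + 1)).choose (p + 1) : ℝ) := by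
    rw [← Nat.cast_sum, Nat.sum_range_add_choose]
    norm_cast
  rw [h5]; ring

/-- iterated sum -/
noncomputable def Dq (a : ℕ → ℝ) (q N : ℕ) : ℝ :=
  ∑ n ∈ Finset.range (N + 1), a n * ((N - n + q).choose q : ℝ)

lemma Dq_zero (a : ℕ → ℝ) (N : ℕ) : Dq a 0 N = ∑ n ∈ Finset.range (N + 1), a n := by
  simp [Dq]

lemma Dq_succ (a : ℕ → ℝ) (q N : ℕ) :
    Dq a (q + 1) N = ∑ n ∈ Finset.range (N + 1), Dq a q n := by
  induction N with
  | zero => simp [Dq]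
  | succ N ih =>
    rw [Finset.sum_range_succ, ← ih]
    unfold Dq
    rw [Finset.sum_range_succ _ (N + 1), Finset.sum_range_succ (fun n => a n * ((N + 1 - n + q).choose q : ℝ)) (N + 1), ← add_assoc (Finset.sum _ _),
      ← Finset.sum_add_distrib]
    congr 1
    · refine Finset.sum_congr rfl fun n hn => ?_
      have hn' : n ≤ N := by simpa [Nat.lt_succ_iff] using hn
      rw [show N + 1 - n + (q + 1) = (N - n + q + 1) + 1 by omega,
        show N + 1 - n + q = N - n + q + 1 by omega, Nat.choose_succ_succ, Nat.cast_add,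
        show N - n + (q + 1) = N - n + q + 1 by omega]
      ring
    · simp

lemma Dq_asym (a : ℕ → ℝ) (p : ℕ) (hp : 1 ≤ p) (α : ℝ)
    (hA : Tendsto (fun N : ℕ => (∑ n ∈ Finset.range (N + 1), a n) / (N : ℝ) ^ p) atTop
      (nhds (α / p.factorial))) (q : ℕ) :
    Tendsto (fun N : ℕ => Dq a q N / (N : ℝ) ^ (p + q)) atTop
      (nhds (α / (p + q).factorial)) := by
  induction q with
  | zero => simpa only [Dq_zero, add_zero] using hA
  | succ q ih =>
    have := cesaro _ (p + q) (by omega) α ih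
    simpa only [Dq_succ, add_assoc] using this

lemma conv_asym (a F : ℕ → ℝ) (ha : ∀ n, 0 ≤ a n) (p q : ℕ) (hp : 1 ≤ p) (hq : 1 ≤ q) (α β : ℝ)
    (hA : Tendsto (fun N : ℕ => (∑ n ∈ Finset.range (N + 1), a n) / (N : ℝ) ^ p) atTop
      (nhds (α / p.factorial)))
    (hF : Tendsto (fun N : ℕ => F N / (N : ℝ) ^ q) atTop (nhds (β / q.factorial))) :
    Tendsto (fun N : ℕ => (∑ n ∈ Finset.range (N + 1), a n * F (N - n)) / (N : ℝ) ^ (p + q)) atTop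
      (nhds (α * β / (p + q).factorial)) := by
  have h1 := conv_error a _ ha p q hq _ hA (err_tendsto F q β hF)
  have h2 := h1.add ((Dq_asym a p hp α hA q).const_mul β)
  rw [zero_add] at h2
  convert h2 using 2 with N
  · rw [mul_div_assoc', ← add_div, Dq, Finset.mul_sum, ← Finset.sum_add_distrib]
    congr 1
    refine Finset.sum_congr rfl fun n _ => ?_
    ring
  · ring

/-- Sum over one residue class. -/
noncomputable def Wsum (d : ℕ) (r : ZMod d) (m n : ℕ) : ℝ :=
  ∑ b ∈ Finset.Icc 1 n, if (b : ZMod d) = r then (b : ℝ) ^ m else 0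

lemma block_card (d : ℕ) (hd : 0 < d) (r : ZMod d) (n : ℕ) :
    ((Finset.Ioc n (n + d)).filter (fun b : ℕ => (b : ZMod d) = r)).card = 1 := by
  have : NeZero d := ⟨hd.ne'⟩
  have h := Nat.Ioc_filter_modEq_card n (n + d) hd r.val
  have h1 : ∀ b : ℕ, (b : ZMod d) = r ↔ b ≡ r.val [MOD d] := by
    intro b
    rw [← ZMod.natCast_eq_natCast_iff, ZMod.natCast_zmod_val]
  simp only [h1]
  have hd' : (d : ℚ) ≠ 0 := by exact_mod_cast hd.ne'
  have h2 : (((n + d : ℕ) : ℚ) - (r.val : ℕ)) / (d : ℚ) = ((n : ℚ) - (r.val : ℕ)) / d + 1 := by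
    push_cast; field_simp; ring
  rw [h2, Int.floor_add_one] at h
  have h3 : (0 : ℤ) ≤ 1 := by norm_num
  simp only [add_sub_cancel_left] at h
  rw [max_eq_left h3] at h
  exact_mod_cast h

lemma Wsum_step (d : ℕ) (hd : 0 < d) (r : ZMod d) (m n : ℕ) :
    Wsum d r m n + (n : ℝ) ^ m ≤ Wsum d r m (n + d) ∧
    Wsum d r m (n + d) ≤ Wsum d r m n + ((n : ℝ) + d) ^ m := by
  have hsplit : Wsum d r m (n + d) = Wsum d r m n +
      ∑ b ∈ (Finset.Ioc n (n + d)).filter (fun b : ℕ => (b : ZMod d) = r), (b : ℝ) ^ m := by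
    unfold Wsum
    rw [Finset.sum_filter]
    have : ∀ n, Finset.Icc 1 n = Finset.Ioc 0 n := fun n => by ext; simp [Nat.succ_le_iff]
    rw [this, this]
    exact (Finset.sum_Ioc_consecutive _ (Nat.zero_le n) (Nat.le_add_right n d)).symm
  obtain ⟨b0, hb0⟩ := Finset.card_eq_one.1 (block_card d hd r n)
  have hmem : b0 ∈ (Finset.Ioc n (n + d)).filter (fun b : ℕ => (b : ZMod d) = r) := by
    rw [hb0]; simp
  rw [hb0, Finset.sum_singleton] at hsplit
  simp only [Finset.mem_filter, Finset.mem_Ioc] at hmem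
  rw [hsplit]
  have h1 : (n : ℝ) ≤ b0 := by exact_mod_cast hmem.1.1.le
  have h2 : (b0 : ℝ) ≤ n + d := by exact_mod_cast hmem.1.2
  constructor <;> gcongr

lemma Wsum_mono (d : ℕ) (r : ZMod d) (m : ℕ) : Monotone (Wsum d r m) := by
  intro n n' h
  unfold Wsum
  refine Finset.sum_le_sum_of_subset_of_nonneg (Finset.Icc_subset_Icc le_rfl h) fun b _ _ => ?_
  split_ifs <;> positivity

lemma Wsum_nonneg (d : ℕ) (r : ZMod d) (m n : ℕ) : 0 ≤ Wsum d r m n := by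
  unfold Wsum
  refine Finset.sum_nonneg fun b _ => ?_
  split_ifs <;> positivity

lemma bern (x t : ℝ) (hx : 0 ≤ x) (ht : 0 ≤ t) (m : ℕ) :
    ((m : ℝ) + 1) * t * x ^ m ≤ (x + t) ^ (m + 1) - x ^ (m + 1) ∧
    (x + t) ^ (m + 1) - x ^ (m + 1) ≤ ((m : ℝ) + 1) * t * (x + t) ^ m := by
  induction m with
  | zero => simp
  | succ m ih =>
    obtain ⟨h1, h2⟩ := ih
    push_cast
    have h3 : x ^ (m + 1) ≤ (x + t) ^ (m + 1) := by gcongr; linarith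
    constructor
    · have : (x + t) ^ (m + 1 + 1) - x ^ (m + 1 + 1)
        = x * ((x + t) ^ (m + 1) - x ^ (m + 1)) + t * (x + t) ^ (m + 1) := by ring
      rw [this]
      have h4 := mul_le_mul_of_nonneg_left h1 hx
      have h5 := mul_le_mul_of_nonneg_left h3 ht
      have : x * (((m : ℝ) + 1) * t * x ^ m) = ((m : ℝ) + 1) * t * x ^ (m + 1) := by ring
      linarith
    · have : (x + t) ^ (m + 1 + 1) - x ^ (m + 1 + 1)
        = (x + t) * ((x + t) ^ (m + 1) - x ^ (m + 1)) + t * x ^ (m + 1) := by ring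
      rw [this]
      have h4 := mul_le_mul_of_nonneg_left h2 (by positivity : 0 ≤ x + t)
      have h5 := mul_le_mul_of_nonneg_left h3 ht
      have : (x + t) * (((m : ℝ) + 1) * t * (x + t) ^ m) = ((m : ℝ) + 1) * t * (x + t) ^ (m + 1) := by ring
      linarith

lemma Wsum_bounds (d : ℕ) (hd : 0 < d) (r : ZMod d) (m : ℕ) : ∀ n : ℕ,
    (n : ℝ) ^ (m + 1) ≤ ((m : ℝ) + 1) * d * Wsum d r m (n + d) ∧
    ((m : ℝ) + 1) * d * Wsum d r m n ≤ ((n : ℝ) + d) ^ (m + 1) := by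
  intro n
  have hd0 : (0 : ℝ) ≤ d := by positivity
  have hc : (0 : ℝ) ≤ ((m : ℝ) + 1) * d := by positivity
  induction n using Nat.strong_induction_on with
  | _ n ih =>
  by_cases hn : n < d
  · have hs := Wsum_step d hd r m n
    have hs0 := (Wsum_step d hd r m 0).2
    have hW0 : Wsum d r m 0 = 0 := by simp [Wsum]
    have hb := bern n d (by positivity) hd0 m
    have hlt : (n : ℝ) ≤ d := by exact_mod_cast hn.le
    constructor
    · have h0 := Wsum_nonneg d r m n
      have h1 : (n : ℝ) ^ m ≤ Wsum d r m (n + d) := by linarith [hs.1]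
      have h2 := mul_le_mul_of_nonneg_left h1 hc
      refine le_trans ?_ h2
      rw [pow_succ, mul_comm]
      refine mul_le_mul_of_nonneg_right ?_ (by positivity)
      have : (0 : ℝ) ≤ m * d := by positivity
      nlinarith
    · have h1 : Wsum d r m n ≤ (n : ℝ) ^ m := by
        have hcard : Wsum d r m n ≤ ∑ b ∈ (Finset.Ioc 0 (0 + d)).filter (fun b : ℕ => (b : ZMod d) = r),
            (n : ℝ) ^ m := by
          unfold Wsum
          rw [← Finset.sum_filter]
          refine (Finset.sum_le_sum (g := fun _ => (n : ℝ) ^ m) ?_).trans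
            (Finset.sum_le_sum_of_subset_of_nonneg ?_ ?_)
          · intro b hb
            simp only [Finset.mem_filter, Finset.mem_Icc] at hb
            have : (b : ℝ) ≤ n := by exact_mod_cast hb.1.2
            gcongr
          · intro b hb
            simp only [Finset.mem_filter, Finset.mem_Icc, Finset.mem_Ioc] at hb ⊢
            exact ⟨by omega, hb.2⟩
          · intros; positivity
        rwa [Finset.sum_const, block_card d hd r 0, one_smul] at hcard
      have h2 := mul_le_mul_of_nonneg_left h1 hc
      have : (0 : ℝ) ≤ (n : ℝ) ^ (m + 1) := by positivity
      linarith [hb.1]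
  · obtain ⟨j, rfl⟩ : ∃ j, n = j + d := ⟨n - d, by omega⟩
    obtain ⟨i1, i2⟩ := ih j (by omega)
    have hs := Wsum_step d hd r m (j + d)
    have hs' := Wsum_step d hd r m j
    have hb := bern j d (by positivity) hd0 m
    have hb' := bern (j + d) d (by positivity) hd0 m
    push_cast at hs ⊢
    constructor
    · have h2 := mul_le_mul_of_nonneg_left hs.1 hc
      linarith [hb.2]
    · have h2 := mul_le_mul_of_nonneg_left hs'.2 hc
      linarith [hb'.1]

lemma shift_pow_tendsto (H : ℕ) (hH : 1 ≤ H) (c : ℝ) (p : ℕ) :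
    Tendsto (fun N : ℕ => (((N / H : ℕ) : ℝ) + c) ^ p / (N : ℝ) ^ p) atTop
      (nhds (1 / (H : ℝ) ^ p)) := by
  have h1 : Tendsto (fun N : ℕ => ((N / H : ℕ) : ℝ) / (N : ℝ)) atTop (nhds ((H : ℝ)⁻¹)) := by
    have := (tendsto_nat_floor_mul_div_atTop (R := ℝ) (a := (H : ℝ)⁻¹) (by positivity)).comp
      tendsto_natCast_atTop_atTop
    refine this.congr fun N => ?_
    simp only [Function.comp]
    rw [inv_mul_eq_div, Nat.floor_div_eq_div]
  have h2 := (h1.add (tendsto_const_div_atTop_nhds_zero_nat c)).pow p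
  rw [add_zero, inv_pow, ← one_div] at h2
  refine h2.congr fun N => ?_
  rw [← add_div, div_pow]

lemma Wsum_asym (d : ℕ) (hd : 0 < d) (r : ZMod d) (m H : ℕ) (hH : 1 ≤ H) :
    Tendsto (fun N : ℕ => Wsum d r m (N / H) / (N : ℝ) ^ (m + 1)) atTop
      (nhds (((m.factorial : ℝ) / (d * (H : ℝ) ^ (m + 1))) / (m + 1).factorial)) := by
  have hd0 : (0 : ℝ) < d := by exact_mod_cast hd
  have hc : (0 : ℝ) < ((m : ℝ) + 1) * d := by positivity
  have hH0 : (0 : ℝ) < H := by exact_mod_cast hH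
  have hlim : (((m.factorial : ℝ) / (d * (H : ℝ) ^ (m + 1))) / (m + 1).factorial)
      = (1 / (H : ℝ) ^ (m + 1)) / (((m : ℝ) + 1) * d) := by
    rw [Nat.factorial_succ]
    have : (m.factorial : ℝ) ≠ 0 := by exact_mod_cast m.factorial_ne_zero
    push_cast
    field_simp
  rw [hlim]
  refine tendsto_of_tendsto_of_tendsto_of_le_of_le'
    ((shift_pow_tendsto H hH (-d) (m + 1)).div_const _)
    ((shift_pow_tendsto H hH d (m + 1)).div_const _) ?_ ?_
  · filter_upwards [eventually_ge_atTop (d * H)] with N hN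
    have hge : d ≤ N / H := (Nat.le_div_iff_mul_le hH).2 hN
    obtain ⟨j, hj⟩ : ∃ j, N / H = j + d := ⟨N / H - d, by omega⟩
    have := (Wsum_bounds d hd r m j).1
    rw [hj, div_div, mul_comm, ← div_div]
    push_cast
    rw [add_neg_cancel_right]
    gcongr
    rw [div_le_iff₀ hc]
    linarith
  · refine Eventually.of_forall fun N => ?_
    have := (Wsum_bounds d hd r m (N / H)).2
    rw [div_div, mul_comm, ← div_div]
    gcongr
    rw [le_div_iff₀ hc]
    linarith

/-- Weight sequence supported on multiples of `H`. -/
noncomputable def av (w : ℕ → ℝ) (H n : ℕ) : ℝ :=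
  ∑ b ∈ Finset.Icc 1 n, if b * H = n then w b else 0

lemma av_nonneg (w : ℕ → ℝ) (hw : ∀ b, 0 ≤ w b) (H n : ℕ) : 0 ≤ av w H n := by
  unfold av
  refine Finset.sum_nonneg fun b _ => ?_
  split_ifs
  · exact hw b
  · exact le_rfl

lemma av_eq (w : ℕ → ℝ) (H n M : ℕ) (hH : 1 ≤ H) (hM : n ≤ M) :
    av w H n = ∑ b ∈ Finset.Icc 1 M, if b * H = n then w b else 0 := by
  unfold av
  refine Finset.sum_subset (Finset.Icc_subset_Icc le_rfl hM) fun b hb hb' => ?_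
  rw [if_neg]
  intro h
  simp only [Finset.mem_Icc, not_and, not_le] at hb hb'
  have := hb' hb.1
  have := Nat.le_mul_of_pos_right b hH
  omega

lemma av_conv (w g : ℕ → ℝ) (H N M : ℕ) (hH : 1 ≤ H) (hM : N ≤ M) :
    ∑ n ∈ Finset.range (N + 1), av w H n * g (N - n) =
      ∑ b ∈ Finset.Icc 1 M, if b * H ≤ N then w b * g (N - b * H) else 0 := by
  have h1 : ∀ n ∈ Finset.range (N + 1), av w H n * g (N - n) =
      ∑ b ∈ Finset.Icc 1 M, if b * H = n then w b * g (N - n) else 0 := by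
    intro n hn
    rw [av_eq w H n M hH (by simp at hn; omega), Finset.sum_mul]
    refine Finset.sum_congr rfl fun b _ => ?_
    split_ifs <;> simp
  rw [Finset.sum_congr rfl h1, Finset.sum_comm]
  refine Finset.sum_congr rfl fun b _ => ?_
  rw [Finset.sum_ite_eq]
  simp

lemma av_sum (w : ℕ → ℝ) (H N : ℕ) (hH : 1 ≤ H) :
    ∑ n ∈ Finset.range (N + 1), av w H n = ∑ b ∈ Finset.Icc 1 (N / H), w b := by
  have := av_conv w (fun _ => 1) H N N hH le_rfl
  simp only [mul_one] at this
  rw [this, ← Finset.sum_filter]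
  refine Finset.sum_congr ?_ fun _ _ => rfl
  ext b
  simp only [Finset.mem_filter, Finset.mem_Icc, Nat.le_div_iff_mul_le hH]
  refine ⟨fun h => ⟨h.1.1, h.2⟩, fun h => ⟨⟨h.1, ?_⟩, h.2⟩⟩
  exact (Nat.le_mul_of_pos_right b hH).trans h.2

/-- Iterated convolution. -/
noncomputable def Tk : (k : ℕ) → (Fin k → ℕ → ℝ) → (Fin k → ℕ) → ℕ → ℝ
  | 0, _, _, _ => 1
  | k + 1, w, H, N => ∑ n ∈ Finset.range (N + 1),
      av (w 0) (H 0) n * Tk k (fun i => w i.succ) (fun i => H i.succ) (N - n)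

lemma sum_piFinset_succ (k : ℕ) (s : Finset ℕ) (f : (Fin (k + 1) → ℕ) → ℝ) :
    ∑ b ∈ Fintype.piFinset (fun _ : Fin (k + 1) => s), f b =
      ∑ x ∈ s, ∑ y ∈ Fintype.piFinset (fun _ : Fin k => s), f (Fin.cons x y) := by
  rw [← Finset.sum_product']
  symm
  refine Finset.sum_bij' (fun p _ => Fin.cons p.1 p.2) (fun b _ => (b 0, fun i => b i.succ))
    ?_ ?_ ?_ ?_ ?_
  · intro p hp
    simp only [Finset.mem_product, Fintype.mem_piFinset] at hp ⊢
    intro i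
    refine Fin.cases ?_ (fun j => ?_) i
    · simpa using hp.1
    · simpa using hp.2 j
  · intro b hb
    simp only [Finset.mem_product, Fintype.mem_piFinset] at hb ⊢
    exact ⟨hb 0, fun i => hb i.succ⟩
  · intro p _; simp
  · intro b _
    ext i
    refine Fin.cases ?_ (fun j => ?_) i <;> simp
  · intro p _; rfl

lemma S_eq_Tk (k : ℕ) : ∀ (w : Fin k → ℕ → ℝ) (H : Fin k → ℕ) (_ : ∀ i, 1 ≤ H i) (M N : ℕ)
    (_ : N ≤ M), (∑ b ∈ Fintype.piFinset (fun _ : Fin k => Finset.Icc 1 M),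
      if ∑ i, b i * H i ≤ N then ∏ i, w i (b i) else 0) = Tk k w H N := by
  induction k with
  | zero => intro w H _ M N _; simp [Tk]
  | succ k ih =>
    intro w H hH M N hM
    rw [sum_piFinset_succ, Tk, av_conv _ _ _ N M (hH 0) hM]
    refine Finset.sum_congr rfl fun x _ => ?_
    simp only [Fin.sum_univ_succ, Fin.prod_univ_succ, Fin.cons_zero, Fin.cons_succ]
    by_cases hx : x * H 0 ≤ N
    · rw [if_pos hx, ← ih _ _ (fun i => hH i.succ) M (N - x * H 0) (by omega), Finset.mul_sum]
      refine Finset.sum_congr rfl fun y _ => ?_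
      by_cases hy : ∑ i, y i * H i.succ ≤ N - x * H 0
      · rw [if_pos hy, if_pos (by omega)]
      · rw [if_neg hy, if_neg (by omega), mul_zero]
    · rw [if_neg hx]
      refine Finset.sum_eq_zero fun y _ => ?_
      rw [if_neg (by omega)]

lemma Tk_asym (k : ℕ) : ∀ (w : Fin (k + 1) → ℕ → ℝ) (H : Fin (k + 1) → ℕ) (p : Fin (k + 1) → ℕ)
    (α : Fin (k + 1) → ℝ) (_ : ∀ i, 1 ≤ p i) (_ : ∀ i b, 0 ≤ w i b)
    (_ : ∀ i, Tendsto (fun N : ℕ => (∑ n ∈ Finset.range (N + 1), av (w i) (H i) n) / (N : ℝ) ^ (p i))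
      atTop (nhds (α i / (p i).factorial))),
    Tendsto (fun N : ℕ => Tk (k + 1) w H N / (N : ℝ) ^ (∑ i, p i)) atTop
      (nhds ((∏ i, α i) / (∑ i, p i).factorial)) := by
  induction k with
  | zero =>
    intro w H p α _ _ h
    simpa [Tk] using h 0
  | succ k ih =>
    intro w H p α hp hw h
    have h1 := ih (fun i => w i.succ) (fun i => H i.succ) (fun i => p i.succ) (fun i => α i.succ)
      (fun i => hp _) (fun i => hw _) (fun i => h _)
    have h2 : 1 ≤ ∑ i : Fin (k + 1), p i.succ :=
      (hp _).trans (Finset.single_le_sum (f := fun i : Fin (k + 1) => p i.succ)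
        (fun _ _ => Nat.zero_le _) (Finset.mem_univ 0))
    have h3 := conv_asym _ _ (av_nonneg (w 0) (hw 0) (H 0)) (p 0) _ (hp 0) h2 _ _ (h 0) h1
    rw [Fin.sum_univ_succ, Fin.prod_univ_succ]
    exact h3

lemma residue_asym (k : ℕ) (hk : 1 ≤ k) (d : ℕ) (hd : 0 < d) (r : Fin k → ZMod d)
    (m H : Fin k → ℕ) (hH : ∀ i, 1 ≤ H i) :
    Tendsto (fun N : ℕ => (∑ b ∈ Fintype.piFinset (fun _ : Fin k => Finset.Icc 1 N),
      if ∑ i, b i * H i ≤ N then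
        ∏ i, (if (b i : ZMod d) = r i then (b i : ℝ) ^ (m i) else 0) else 0) /
        (N : ℝ) ^ ((∑ i, m i) + k)) atTop
      (nhds ((∏ i, ((m i).factorial : ℝ) / (d * (H i : ℝ) ^ (m i + 1))) /
        (((∑ i, m i) + k).factorial : ℝ))) := by
  obtain ⟨k, rfl⟩ : ∃ j, k = j + 1 := ⟨k - 1, by omega⟩
  have h := Tk_asym k (fun i b => if (b : ZMod d) = r i then (b : ℝ) ^ (m i) else 0) H
    (fun i => m i + 1) (fun i => ((m i).factorial : ℝ) / (d * (H i : ℝ) ^ (m i + 1)))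
    (fun i => by omega) (fun i b => by split_ifs <;> positivity)
    (fun i => by
      have := Wsum_asym d hd (r i) (m i) (H i) (hH i)
      refine this.congr fun N => ?_
      rw [av_sum _ _ _ (hH i)]
      rfl)
  have hs : ∑ i, (m i + 1) = (∑ i, m i) + (k + 1) := by simp [Finset.sum_add_distrib]
  simp only [hs] at h
  refine h.congr fun N => ?_
  rw [← S_eq_Tk (k + 1) _ H hH N N le_rfl]

lemma index_card (k : ℕ) (L : AddSubgroup (Fin k → ℤ)) (hL : L.index ≠ 0) :
    ∃ R : Finset (Fin k → ZMod L.index), (R.card : ℝ) * L.index = (L.index : ℝ) ^ k ∧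
      ∀ b : Fin k → ℕ, ((fun i => (b i : ℤ)) ∈ L ↔ (fun i => (b i : ZMod L.index)) ∈ R) := by
  set d := L.index with hdd
  have : NeZero d := ⟨hL⟩
  let f : (Fin k → ℤ) →+ (Fin k → ZMod d) :=
    { toFun := fun v i => (v i : ZMod d)
      map_zero' := by ext; simp
      map_add' := fun x y => by ext; simp }
  have hf : Function.Surjective f := by
    intro v
    refine ⟨fun i => ((v i).val : ℤ), ?_⟩
    ext i
    simp [f]
  have hker : f.ker ≤ L := by
    intro v hv
    have h1 : ∀ i, (d : ℤ) ∣ v i := by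
      intro i
      have := congrFun (f.mem_ker.1 hv) i
      exact (ZMod.intCast_zmod_eq_zero_iff_dvd _ _).1 this
    choose u hu using h1
    have h2 : v = d • u := by
      ext i
      simp [hu i]
    rw [h2]
    exact L.nsmul_index_mem u
  have hidx := AddSubgroup.index_map_eq L hf hker
  have hcard := AddSubgroup.card_mul_index (L.map f)
  rw [hidx, ← hdd] at hcard
  refine ⟨Finset.univ.filter (fun v => v ∈ L.map f), ?_, ?_⟩
  · have h3 : (Finset.univ.filter (fun v => v ∈ L.map f)).card = Nat.card (L.map f) := by
      rw [Nat.card_eq_fintype_card, Fintype.card_subtype]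
    rw [h3]
    have : Nat.card (Fin k → ZMod d) = d ^ k := by simp [Nat.card_eq_fintype_card, ZMod.card]
    rw [this] at hcard
    exact_mod_cast hcard
  · intro b
    simp only [Finset.mem_filter, Finset.mem_univ, true_and]
    have : (fun i => (b i : ZMod d)) = f (fun i => (b i : ℤ)) := by ext i; simp [f]
    rw [this, ← AddSubgroup.mem_comap, AddSubgroup.comap_map_eq_self hker]

lemma fixed_asym (k : ℕ) (hk : 1 ≤ k)
    (L : AddSubgroup (Fin k → ℤ)) (hL : L.index ≠ 0)
    (m H : Fin k → ℕ) (hH : ∀ i, 1 ≤ H i) :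
      Filter.Tendsto
        (fun N : ℕ => latticeSumFixed k L m H N / (N : ℝ) ^ ((∑ i, m i) + k))
        atTop
        (nhds ((1 / (L.index : ℝ)) * (1 / (Nat.factorial ((∑ i, m i) + k) : ℝ)) *
          ∏ i, ((Nat.factorial (m i) : ℝ) / (H i : ℝ) ^ (m i + 1)))) := by
  obtain ⟨R, hR, hmem⟩ := index_card k L hL
  have h := tendsto_finsetSum R fun r _ =>
    residue_asym k hk L.index (Nat.pos_of_ne_zero hL) r m H hH
  rw [Finset.sum_const, nsmul_eq_mul] at h
  have hd : (L.index : ℝ) ≠ 0 := by exact_mod_cast hL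
  convert h using 2 with N
  · rw [← Finset.sum_div, Finset.sum_comm]
    congr 1
    unfold latticeSumFixed
    refine Finset.sum_congr rfl fun b _ => ?_
    by_cases hb : ∑ i, b i * H i ≤ N
    · simp only [hb, true_and, if_true, Finset.prod_ite_zero, Finset.mem_univ, true_imp_iff]
      have : ∀ r : Fin k → ZMod L.index, (∀ i, (b i : ZMod L.index) = r i) ↔
        (fun i => (b i : ZMod L.index)) = r := fun r => funext_iff.symm
      simp only [this, hmem, Finset.sum_ite_eq]
    · simp [hb]
  · have h4 : (∏ i, ((m i).factorial : ℝ) / (L.index * (H i : ℝ) ^ (m i + 1))) =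
      (∏ i, (((m i).factorial : ℝ) / (H i : ℝ) ^ (m i + 1))) / (L.index : ℝ) ^ k := by
      rw [show (L.index : ℝ) ^ k = ∏ _i : Fin k, (L.index : ℝ) by simp, ← Finset.prod_div_distrib]
      refine Finset.prod_congr rfl fun i _ => ?_
      rw [div_div, mul_comm]
    rw [h4, ← hR]
    have hRc : (R.card : ℝ) ≠ 0 := by
      intro h0
      rw [h0, zero_mul] at hR
      exact pow_ne_zero _ hd hR.symm
    field_simp

lemma fixed_bound (k : ℕ) (L : AddSubgroup (Fin k → ℤ)) (m H : Fin k → ℕ) (hH : ∀ i, 1 ≤ H i)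
    (N : ℕ) : latticeSumFixed k L m H N ≤
      (N : ℝ) ^ ((∑ i, m i) + k) * ∏ i, (1 / (H i : ℝ) ^ (m i + 1)) := by
  have h1 : latticeSumFixed k L m H N ≤ ∑ b ∈ Fintype.piFinset (fun _ : Fin k => Finset.Icc 1 N),
      ∏ i, (if b i * H i ≤ N then (b i : ℝ) ^ (m i) else 0) := by
    unfold latticeSumFixed
    refine Finset.sum_le_sum fun b _ => ?_
    rw [Finset.prod_ite_zero]
    by_cases hb : (∑ i, b i * H i ≤ N) ∧ ((fun i => (b i : ℤ)) ∈ L)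
    · rw [if_pos hb, if_pos]
      intro i _
      exact (Finset.single_le_sum (f := fun i => b i * H i) (fun _ _ => Nat.zero_le _)
        (Finset.mem_univ i)).trans hb.1
    · rw [if_neg hb]
      split_ifs <;> positivity
  rw [Finset.sum_prod_piFinset (Finset.Icc 1 N)
    (fun i x => if x * H i ≤ N then (x : ℝ) ^ (m i) else 0)] at h1
  refine h1.trans ?_
  have h2 : (N : ℝ) ^ ((∑ i, m i) + k) * ∏ i, (1 / (H i : ℝ) ^ (m i + 1)) =
      ∏ i, ((N : ℝ) / H i) ^ (m i + 1) := by
    have hs : (∑ i, m i) + k = ∑ i, (m i + 1) := by simp [Finset.sum_add_distrib]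
    rw [hs, ← Finset.prod_pow_eq_pow_sum, ← Finset.prod_mul_distrib]
    refine Finset.prod_congr rfl fun i _ => ?_
    rw [div_pow, mul_one_div]
  rw [h2]
  refine Finset.prod_le_prod (fun i _ => Finset.sum_nonneg fun b _ => ?_) fun i _ => ?_
  · split_ifs <;> positivity
  · have hHi : (0 : ℝ) < H i := by exact_mod_cast hH i
    have h3 : ∑ x ∈ Finset.Icc 1 N, (if x * H i ≤ N then (x : ℝ) ^ (m i) else 0) ≤
        ∑ x ∈ Finset.Icc 1 (N / H i), ((N : ℝ) / H i) ^ (m i) := by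
      rw [← Finset.sum_filter]
      refine (Finset.sum_le_sum (g := fun _ => ((N : ℝ) / H i) ^ (m i)) ?_).trans
        (Finset.sum_le_sum_of_subset_of_nonneg ?_ ?_)
      · intro b hb
        simp only [Finset.mem_filter] at hb
        have : (b : ℝ) ≤ N / H i := by
          rw [le_div_iff₀ hHi]; exact_mod_cast hb.2
        gcongr
      · intro b hb
        simp only [Finset.mem_filter, Finset.mem_Icc, Nat.le_div_iff_mul_le (hH i)] at hb ⊢
        exact ⟨hb.1.1, hb.2⟩
      · intros; positivity
    refine h3.trans ?_
    rw [Finset.sum_const, Nat.card_Icc, Nat.add_sub_cancel, nsmul_eq_mul, pow_succ, mul_comm]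
    have : ((N / H i : ℕ) : ℝ) ≤ N / H i := Nat.cast_div_le
    gcongr

lemma tsum_pi (k : ℕ) : ∀ (g : Fin k → ℕ → ℝ) (_ : ∀ i n, 0 ≤ g i n) (_ : ∀ i, Summable (g i)),
    HasSum (fun h : Fin k → ℕ => ∏ i, g i (h i)) (∏ i, ∑' n, g i n) := by
  induction k with
  | zero => intro g _ _; simp
  | succ k ih =>
    intro g h0 hs
    have h1 := ih (fun i => g i.succ) (fun i => h0 _) (fun i => hs _)
    obtain ⟨G, hG⟩ : ∃ G : (Fin k → ℕ) → ℝ, G = fun h => ∏ i : Fin k, g i.succ (h i) := ⟨_, rfl⟩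
    rw [← hG] at h1
    have hG0 : ∀ h, 0 ≤ G h := fun h => by
      rw [hG]; exact Finset.prod_nonneg fun i _ => h0 _ _
    have h3 : Summable (fun x : ℕ × (Fin k → ℕ) => g 0 x.1 * G x.2) :=
      Summable.mul_of_nonneg (hs 0) h1.summable (h0 0) hG0
    have h2 : HasSum (fun x : ℕ × (Fin k → ℕ) => g 0 x.1 * G x.2)
        ((∑' n, g 0 n) * ∏ i : Fin k, ∑' n, g i.succ n) :=
      HasSum.mul (hs 0).hasSum h1 h3
    rw [Fin.prod_univ_succ, ← (Fin.consEquiv (fun _ => ℕ)).hasSum_iff]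
    convert h2 using 1
    funext x
    simp [Fin.prod_univ_succ, Fin.consEquiv, hG]

lemma fixed_zero (k : ℕ) (L : AddSubgroup (Fin k → ℤ)) (m H : Fin k → ℕ) (N : ℕ)
    (i : Fin k) (hi : N < H i) : latticeSumFixed k L m H N = 0 := by
  unfold latticeSumFixed
  refine Finset.sum_eq_zero fun b hb => if_neg ?_
  rintro ⟨h, -⟩
  have h1 := (Finset.single_le_sum (f := fun i => b i * H i) (fun _ _ => Nat.zero_le _)
        (Finset.mem_univ i)).trans h
  have h2 := (Finset.mem_Icc.1 (Fintype.mem_piFinset.1 hb i)).1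
  have := Nat.le_mul_of_pos_left (H i) h2
  omega

lemma lattice_eq_tsum (k : ℕ) (L : AddSubgroup (Fin k → ℤ)) (m : Fin k → ℕ) (N : ℕ) :
    latticeSum k L m N = ∑' h : Fin k → ℕ, latticeSumFixed k L m (fun i => h i + 1) N := by
  rw [tsum_eq_sum (s := Fintype.piFinset (fun _ : Fin k => Finset.range N))]
  · unfold latticeSum latticeSumFixed
    rw [Finset.sum_comm]
    refine Finset.sum_bij' (fun H _ => fun i => H i - 1) (fun h _ => fun i => h i + 1) ?_ ?_ ?_ ?_ ?_
    · intro H hH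
      simp only [Fintype.mem_piFinset, Finset.mem_Icc, Finset.mem_range] at hH ⊢
      intro i; have := hH i; omega
    · intro H hH
      simp only [Fintype.mem_piFinset, Finset.mem_Icc, Finset.mem_range] at hH ⊢
      intro i; have := hH i; omega
    · intro H hH
      simp only [Fintype.mem_piFinset, Finset.mem_Icc] at hH
      ext i; have := hH i; simp only; omega
    · intro H hH
      ext i; simp
    · intro H hH
      simp only [Fintype.mem_piFinset, Finset.mem_Icc] at hH
      have : (fun i => H i - 1 + 1) = H := by ext i; have := hH i; omega
      have h2 : ∀ i, H i - 1 + 1 = H i := fun i => congrFun this i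
      simp only [h2]
  · intro h hh
    simp only [Fintype.mem_piFinset, Finset.mem_range, not_forall, not_lt] at hh
    obtain ⟨i, hi⟩ := hh
    exact fixed_zero k L m _ N i (by omega)

lemma fixed_nonneg (k : ℕ) (L : AddSubgroup (Fin k → ℤ)) (m H : Fin k → ℕ) (N : ℕ) :
    0 ≤ latticeSumFixed k L m H N := by
  unfold latticeSumFixed
  refine Finset.sum_nonneg fun b _ => ?_
  split_ifs <;> positivity

lemma full_asym (k : ℕ) (hk : 1 ≤ k)
    (L : AddSubgroup (Fin k → ℤ)) (hL : L.index ≠ 0)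
    (m : Fin k → ℕ) (hm : ∀ i, 1 ≤ m i) :
    Filter.Tendsto
      (fun N : ℕ => latticeSum k L m N / (N : ℝ) ^ ((∑ i, m i) + k))
      atTop
      (nhds ((1 / (L.index : ℝ)) * (1 / (Nat.factorial ((∑ i, m i) + k) : ℝ)) *
        ∏ i, ((Nat.factorial (m i) : ℝ) * zetaSum (m i + 1)))) := by
  have hsum : ∀ i, Summable (fun n : ℕ => 1 / ((n : ℝ) + 1) ^ (m i + 1)) := by
    intro i
    have := (summable_nat_add_iff 1).2
      (Real.summable_one_div_nat_pow.2 (by have := hm i; omega : 1 < m i + 1))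
    simpa using this
  have hbs := tsum_pi k (fun i n => 1 / ((n : ℝ) + 1) ^ (m i + 1)) (fun i n => by positivity) hsum
  have hlim := tsum_pi k (fun i n => ((m i).factorial : ℝ) / ((n : ℝ) + 1) ^ (m i + 1))
    (fun i n => by positivity) (fun i => by
      have := (hsum i).mul_left ((m i).factorial : ℝ)
      simpa only [mul_one_div] using this)
  have hz : ∀ i, ∑' n : ℕ, ((m i).factorial : ℝ) / ((n : ℝ) + 1) ^ (m i + 1) =
      ((m i).factorial : ℝ) * zetaSum (m i + 1) := by
    intro i
    unfold zetaSum
    rw [← tsum_mul_left]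
    simp only [mul_one_div]
  simp only [hz] at hlim
  rw [← hlim.tsum_eq, ← tsum_mul_left]
  simp only [lattice_eq_tsum, ← tsum_div_const]
  refine tendsto_tsum_of_dominated_convergence hbs.summable ?_ ?_
  · intro h
    have := fixed_asym k hk L hL m (fun i => h i + 1) (fun i => by omega)
    simpa only [Nat.cast_add, Nat.cast_one] using this
  · filter_upwards [eventually_gt_atTop 0] with N hN h
    have hN' : (0 : ℝ) < N := by exact_mod_cast hN
    have hb := fixed_bound k L m (fun i => h i + 1) (fun i => by omega) N
    rw [Real.norm_eq_abs, abs_of_nonneg (div_nonneg (fixed_nonneg _ _ _ _ _) (by positivity)),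
      div_le_iff₀ (by positivity), mul_comm]
    simpa only [Nat.cast_add, Nat.cast_one] using hb

/-- Let `L ≤ ℤ^k` be a subgroup of finite index `d` and `m₁,…,m_k ≥ 1`. Then
(i) `lim_{N→∞} N^{−(|m|+k)} ∑_{b⋅H ≤ N, b ∈ L} b^m = (1/d)·(1/(|m|+k)!)·∏ᵢ mᵢ!·ζ(mᵢ+1)`,
and (ii) for every fixed tuple `H` of positive integers,
`lim_{N→∞} N^{−(|m|+k)} ∑_{b⋅H ≤ N, b ∈ L} b^m = (1/d)·(1/(|m|+k)!)·∏ᵢ mᵢ!/Hᵢ^{mᵢ+1}`. -/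
theorem lattice_count_asymptotics (k : ℕ) (hk : 1 ≤ k)
    (L : AddSubgroup (Fin k → ℤ)) (hL : L.index ≠ 0)
    (m : Fin k → ℕ) (hm : ∀ i, 1 ≤ m i) :
    Filter.Tendsto
      (fun N : ℕ => latticeSum k L m N / (N : ℝ) ^ ((∑ i, m i) + k))
      atTop
      (nhds ((1 / (L.index : ℝ)) * (1 / (Nat.factorial ((∑ i, m i) + k) : ℝ)) *
        ∏ i, ((Nat.factorial (m i) : ℝ) * zetaSum (m i + 1)))) ∧
    ∀ H : Fin k → ℕ, (∀ i, 1 ≤ H i) →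
      Filter.Tendsto
        (fun N : ℕ => latticeSumFixed k L m H N / (N : ℝ) ^ ((∑ i, m i) + k))
        atTop
        (nhds ((1 / (L.index : ℝ)) * (1 / (Nat.factorial ((∑ i, m i) + k) : ℝ)) *
          ∏ i, ((Nat.factorial (m i) : ℝ) / (H i : ℝ) ^ (m i + 1)))) := by
  exact ⟨full_asym k hk L hL m hm, fun H hH => fixed_asym k hk L hL m H hH⟩
end
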